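/- arXiv:math/0304463 — 4 statements merged into one kernel-verified Lean document; each statement's English description precedes it below -/
import Mathlib

section
/- Let q = p^n with p prime, let f : GF(q) → GF(q) satisfy f(0) = 0, and let N = |D_f|. Let e, with 0 ≤ e ≤ n, be the largest integer such that for every m ∈ D_f and every c ∈ GF(q) the number of x ∈ GF(q) with f(x) = m·x + c is divisible by p^e. Then one of the following holds: (1) e = 0 and (q+3)/2 ≤ N ≤ q+1; (2) e = 1, p = 2 and (q+5)/3 ≤ N ≤ q−1; (3) p^e > 2, e divides n, and q/p^e + 1 ≤ N ≤ (q−1)/(p^e−1); (4) e = n and N = 1. Moreover, if p^e > 3, or if p^e = 3 and N = q/3 + 1, then f is additive (f(x+y) = f(x) + f(y) for all x, y ∈ GF(q)) and satisfies f(c·x) = c·f(x) for every x ∈ GF(q) and every c ∈ GF(q) with c^{p^e} = c; that is, f is a linear map on GF(q) viewed as a vector space over the subfield GF(p^e). -/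
namespace Directions

open Polynomial

section Redei

/-- The coefficients, of total degree at least the number of factors, of a product of linear
polynomials in two variables. -/
theorem coeff_coeff_prod_linear {R ι : Type*} [CommRing R] [Nontrivial R] (s : Finset ι) (a b : ι → R) (k l : ℕ) :
    (s.card < k + l →
      ((∏ i ∈ s, (X - C (C (a i) - C (b i) * X)) : R[X][X]).coeff k).coeff l = 0) ∧
    (s.card = k + l →
      ((∏ i ∈ s, (X - C (C (a i) - C (b i) * X)) : R[X][X]).coeff k).coeff l =
        (∏ i ∈ s, (X + C (b i))).coeff k) := by
  classical
  induction s using Finset.induction_on generalizing k l with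
  | empty =>
    constructor
    · intro h
      simp only [Finset.card_empty, Finset.prod_empty, coeff_one] at h ⊢
      split_ifs with hk
      · rw [coeff_one, if_neg (by omega)]
      · simp
    · intro h
      obtain ⟨rfl, rfl⟩ : k = 0 ∧ l = 0 := by simp at h; omega
      simp
  | insert j s hj ih =>
    rw [Finset.card_insert_of_notMem hj, Finset.prod_insert hj, Finset.prod_insert hj]
    set P : R[X][X] := ∏ i ∈ s, (X - C (C (a i) - C (b i) * X)) with hP
    have key : ((X - C (C (a j) - C (b j) * X)) * P : R[X][X]) =
        X * P - C (C (a j)) * P + C (C (b j)) * (C X * P) := by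
      simp only [map_sub, map_mul]; ring
    rw [key, add_mul]
    simp only [coeff_add, coeff_sub, coeff_C_mul]
    have h2 := (ih k l).1
    constructor
    · intro h
      have h1 : ((X * P).coeff k).coeff l = 0 := by
        rcases k with _ | k
        · simp
        · rw [coeff_X_mul]; exact (ih k l).1 (by omega)
      have h3 : (X * P.coeff k : R[X]).coeff l = 0 := by
        rcases l with _ | l
        · simp
        · rw [coeff_X_mul]; exact (ih k l).1 (by omega)
      rw [h1, h2 (by omega), h3]; simp
    · intro h
      have h1 : ((X * P).coeff k).coeff l = (X * ∏ i ∈ s, (X + C (b i))).coeff k := by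
        rcases k with _ | k
        · simp
        · rw [coeff_X_mul, coeff_X_mul]; exact (ih k l).2 (by omega)
      have h3 : (X * P.coeff k : R[X]).coeff l = (∏ i ∈ s, (X + C (b i))).coeff k := by
        rcases l with _ | l
        · have : (∏ i ∈ s, (X + C (b i))).coeff k = 0 := by
            apply coeff_eq_zero_of_natDegree_lt
            refine lt_of_le_of_lt (natDegree_prod_le _ _) ?_
            refine lt_of_le_of_lt (Finset.sum_le_card_nsmul _ _ 1 fun i _ => ?_) ?_
            · exact (natDegree_X_add_C _).le
            · simp; omega
          simp [this]
        · rw [coeff_X_mul]; exact (ih k l).2 (by omega)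
      rw [h1, h2 (by omega), h3]; simp

variable {F : Type*} [Field F] [Fintype F]

open Classical in
/-- The points of the graph of `f` on the line `z = y x + c`. -/
noncomputable def line (f : F → F) (y c : F) : Finset F := {x | f x = y * x + c}

open Classical in
/-- The directions determined by `f`. -/
noncomputable def dirs (f : F → F) : Finset F :=
  {m | ∃ u v : F, u ≠ v ∧ m = (f u - f v) / (u - v)}

/-- The Rédei polynomial of the graph of `f`. -/
noncomputable def redei (f : F → F) : F[X][X] := ∏ x, (X - C (C (f x) - C x * X))

/-- The Rédei polynomial, specialised at the slope `y`. -/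
noncomputable def slopePoly (f : F → F) (y : F) : F[X] := ∏ x, (X - C (f x - y * x))

variable {f : F → F}

theorem mem_line {y c x : F} : x ∈ line f y c ↔ f x - y * x = c := by
  simp [line, sub_eq_iff_eq_add, add_comm]

theorem mem_dirs {y : F} : y ∈ dirs f ↔ ∃ u v : F, u ≠ v ∧ f u - y * u = f v - y * v := by
  simp only [dirs, Finset.mem_filter, Finset.mem_univ, true_and]
  refine exists_congr fun u => exists_congr fun v => and_congr_right fun h => ?_
  rw [eq_div_iff (sub_ne_zero.mpr h)]
  constructor <;> intro h <;> linear_combination -h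

theorem dirs_nonempty : (dirs f).Nonempty :=
  ⟨(f 0 - f 1) / (0 - 1), by simp only [dirs, Finset.mem_filter, Finset.mem_univ, true_and]
                             exact ⟨0, 1, zero_ne_one, rfl⟩⟩

theorem map_redei (y : F) : (redei f).map (evalRingHom y) = slopePoly f y := by
  simp [redei, slopePoly, Polynomial.map_prod, mul_comm y]

theorem eval_coeff_redei (y : F) (k : ℕ) : ((redei f).coeff k).eval y = (slopePoly f y).coeff k := by
  rw [← map_redei, coeff_map, coe_evalRingHom]

theorem prod_X_sub_C_univ : ∏ x : F, (X - C x) = X ^ Fintype.card F - X := by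
  have h := FiniteField.roots_X_pow_card_sub_X F
  have hm : (X ^ Fintype.card F - X : F[X]).Monic :=
    monic_X_pow_sub (by rw [degree_X]; exact_mod_cast Fintype.one_lt_card)
  have := prod_multiset_X_sub_C_of_monic_of_roots_card_eq hm
    (by rw [h, FiniteField.X_pow_card_sub_X_natDegree_eq _ Fintype.one_lt_card]; rfl)
  rw [h] at this
  exact this

theorem slopePoly_of_notMem {y : F} (hy : y ∉ dirs f) :
    slopePoly f y = X ^ Fintype.card F - X := by
  have hinj : Function.Injective fun x => f x - y * x := by
    intro u v h
    by_contra hne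
    exact hy (mem_dirs.mpr ⟨u, v, hne, h⟩)
  rw [← prod_X_sub_C_univ]
  exact Fintype.prod_bijective _ (Finite.injective_iff_bijective.mp hinj) _ _ fun _ => rfl

theorem natDegree_slopePoly (y : F) : (slopePoly f y).natDegree = Fintype.card F := by
  rw [slopePoly, natDegree_finsetProd_X_sub_C_eq_card, Finset.card_univ]

theorem monic_slopePoly (y : F) : (slopePoly f y).Monic :=
  monic_prod_X_sub_C _ _

theorem coeff_redei_eq_zero_of_lt {k l : ℕ} (h : Fintype.card F < k + l) :
    ((redei f).coeff k).coeff l = 0 :=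
  (coeff_coeff_prod_linear Finset.univ f id k l).1 (by simpa using h)

theorem coeff_redei_eq_zero_of_eq {k l : ℕ} (h : Fintype.card F = k + l)
    (h1 : k ≠ 1) (hl : l ≠ 0) : ((redei f).coeff k).coeff l = 0 := by
  refine ((coeff_coeff_prod_linear Finset.univ f id k l).2 (by simpa using h)).trans ?_
  have : ∏ x : F, (X + C (id x)) = X ^ Fintype.card F - X := by
    rw [← prod_X_sub_C_univ]
    exact Fintype.prod_equiv (Equiv.neg F) _ _ fun x => by simp
  rw [this, coeff_sub, coeff_X_pow, coeff_X, if_neg (by omega), if_neg (by omega), sub_zero]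

theorem natDegree_coeff_redei_lt {k : ℕ} (h1 : k ≠ 1) (hk : k < Fintype.card F) :
    ((redei f).coeff k).natDegree < Fintype.card F - k := by
  refine Nat.lt_of_le_pred (by omega) (natDegree_le_iff_coeff_eq_zero.mpr fun l hl => ?_)
  rw [Nat.pred_eq_sub_one] at hl
  rcases Nat.lt_or_ge (Fintype.card F) (k + l) with h | h
  · exact coeff_redei_eq_zero_of_lt h
  · exact coeff_redei_eq_zero_of_eq (by omega) h1 (by omega)

theorem coeff_redei_eq_zero_of_card_dirs_le {k : ℕ} (h1 : k ≠ 1) (hk : k < Fintype.card F)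
    (hN : (dirs f).card ≤ k) : (redei f).coeff k = 0 := by
  classical
  refine eq_zero_of_natDegree_lt_card_of_eval_eq_zero' _ (dirs f)ᶜ (fun y hy => ?_) ?_
  · rw [eval_coeff_redei, slopePoly_of_notMem (by simpa using hy), coeff_sub, coeff_X_pow, coeff_X,
      if_neg hk.ne, if_neg h1.symm, sub_zero]
  · rw [Finset.card_compl]
    exact (natDegree_coeff_redei_lt h1 hk).trans_le (by omega)

theorem coeff_slopePoly_eq_zero_of_card_dirs_le {k : ℕ} (h1 : k ≠ 1) (hk : k < Fintype.card F)
    (hN : (dirs f).card ≤ k) (y : F) : (slopePoly f y).coeff k = 0 := by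
  rw [← eval_coeff_redei, coeff_redei_eq_zero_of_card_dirs_le h1 hk hN, eval_zero]

end Redei

section Lines

variable {F : Type*} [Field F] [Fintype F] {f : F → F}

theorem slopePoly_eq_prod (f : F → F) (y : F) :
    slopePoly f y = ∏ c, (X - C c) ^ (line f y c).card := by
  classical
  rw [slopePoly, ← Finset.prod_fiberwise' Finset.univ (fun x => f x - y * x) fun c => X - C c]
  refine Finset.prod_congr rfl fun c _ => ?_
  rw [Finset.prod_const]
  congr 2
  ext x
  simp [mem_line]

theorem slopePoly_eq_pow {y : F} {s : ℕ} (h : ∀ c, s ∣ (line f y c).card) :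
    slopePoly f y = (∏ c, (X - C c) ^ ((line f y c).card / s)) ^ s := by
  rw [slopePoly_eq_prod, ← Finset.prod_pow]
  refine Finset.prod_congr rfl fun c _ => ?_
  rw [← pow_mul, Nat.div_mul_cancel (h c)]

variable {p : ℕ} [Fact p.Prime] [CharP F p]

theorem coeff_pow_char_pow_mul {R : Type*} [CommRing R] [CharP R p] (g : R[X]) (e k : ℕ) :
    (g ^ p ^ e).coeff (p ^ e * k) = g.coeff k ^ p ^ e := by
  rw [← map_iterateFrobenius_expand, coeff_map, mul_comm,
    coeff_expand_mul (Nat.pow_pos (Fact.out : p.Prime).pos), iterateFrobenius_def]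

theorem coeff_pow_char_pow_of_not_dvd {R : Type*} [CommRing R] [CharP R p] (g : R[X]) {e k : ℕ}
    (h : ¬ p ^ e ∣ k) : (g ^ p ^ e).coeff k = 0 := by
  rw [← map_iterateFrobenius_expand, coeff_map,
    coeff_expand (Nat.pow_pos (Fact.out : p.Prime).pos), if_neg h, map_zero]

theorem coeff_redei_eq_zero_of_not_dvd (hf : ∀ y ∈ dirs f, ∀ c, p ∣ (line f y c).card) {k : ℕ}
    (h1 : k ≠ 1) (hk : ¬ p ∣ k) : (redei f).coeff k = 0 := by
  have hk0 : k ≠ 0 := by rintro rfl; simp at hk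
  have hpq : p ∣ Fintype.card F := (CharP.cast_eq_zero_iff F p _).mp (by simp)
  have hkq : k ≠ Fintype.card F := by rintro rfl; exact hk hpq
  rcases Nat.lt_or_ge (Fintype.card F) k with h | h
  · ext l
    rw [coeff_redei_eq_zero_of_lt (by omega), coeff_zero]
  refine eq_zero_of_natDegree_lt_card_of_eval_eq_zero' _ Finset.univ (fun y _ => ?_) ?_
  · rw [eval_coeff_redei]
    by_cases hy : y ∈ dirs f
    · rw [slopePoly_eq_pow (hf y hy)]
      have := coeff_pow_char_pow_of_not_dvd (p := p) (e := 1)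
        (∏ c, (X - C c) ^ ((line f y c).card / p)) (by rwa [pow_one])
      rwa [pow_one] at this
    · rw [slopePoly_of_notMem hy, coeff_sub, coeff_X_pow, coeff_X, if_neg hkq, if_neg h1.symm,
        sub_zero]
  · rw [Finset.card_univ]
    exact (natDegree_coeff_redei_lt h1 (by omega)).trans_le (by omega)

theorem derivative_redei (hf : ∀ y ∈ dirs f, ∀ c, p ∣ (line f y c).card) :
    derivative (redei f) = C ((redei f).coeff 1) := by
  ext1 k
  rw [coeff_derivative, coeff_C]
  split_ifs with hk
  · simp [hk]
  · by_cases hp : p ∣ k + 1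
    · have : ((k : F[X]) + 1) = 0 := by exact_mod_cast (CharP.cast_eq_zero_iff F[X] p _).mpr hp
      rw [this, mul_zero]
    · rw [coeff_redei_eq_zero_of_not_dvd hf (by omega) hp, zero_mul]

open Classical in
theorem coeff_one_redei (hf : ∀ y ∈ dirs f, ∀ c, p ∣ (line f y c).card) (a : F) :
    (redei f).coeff 1 =
      ∏ x ∈ Finset.univ.erase a, (C (x - a) * (X - C ((f x - f a) / (x - a)))) := by
  have h : eval (C (f a) - C a * X) (derivative (redei f)) = (redei f).coeff 1 := by
    rw [derivative_redei hf, eval_C]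
  rw [← h, redei, derivative_prod_finset, eval_finsetSum,
    Finset.sum_eq_single_of_mem a (Finset.mem_univ _)]
  · rw [derivative_X_sub_C, mul_one, eval_prod]
    refine Finset.prod_congr rfl fun x hx => ?_
    have hx : x - a ≠ 0 := sub_ne_zero.mpr (Finset.ne_of_mem_erase hx)
    rw [mul_sub, ← C_mul, mul_div_cancel₀ _ hx]
    simp only [eval_sub, eval_X, eval_C, C_sub]
    ring
  · intro b _ hb
    rw [eval_mul, eval_prod, Finset.prod_eq_zero (i := a) (by simp [hb.symm]) (by simp), zero_mul]

theorem rootMultiplicity_coeff_one_redei (hf : ∀ y ∈ dirs f, ∀ c, p ∣ (line f y c).card) (a y : F) :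
    ((redei f).coeff 1).rootMultiplicity y + 1 = (line f y (f a - y * a)).card := by
  classical
  have hne : ∀ x ∈ Finset.univ.erase a, C (x - a) * (X - C ((f x - f a) / (x - a))) ≠ 0 :=
    fun x hx => mul_ne_zero (C_ne_zero.mpr (sub_ne_zero.mpr (Finset.ne_of_mem_erase hx)))
      (X_sub_C_ne_zero _)
  rw [← count_roots, coeff_one_redei hf a, roots_prod _ _ (Finset.prod_ne_zero_iff.mpr hne),
    Multiset.count_bind]
  have : line f y (f a - y * a) =
      insert a ((Finset.univ.erase a).filter fun x => y = (f x - f a) / (x - a)) := by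
    ext x
    simp only [mem_line, Finset.mem_insert, Finset.mem_filter, Finset.mem_erase, Finset.mem_univ,
      and_true]
    by_cases hx : x = a
    · simp [hx]
    · simp only [hx, false_or, not_false_eq_true, true_and, ne_eq]
      rw [eq_div_iff (sub_ne_zero.mpr hx)]
      constructor <;> intro h <;> linear_combination -h
  rw [this, Finset.card_insert_of_notMem (by simp), Finset.card_filter]
  congr 1
  change ∑ x ∈ Finset.univ.erase a, _ = _
  refine Finset.sum_congr rfl fun x hx => ?_
  rw [roots_C_mul _ (sub_ne_zero.mpr (Finset.ne_of_mem_erase hx)), roots_X_sub_C,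
    Multiset.count_singleton]

theorem card_line_of_nonempty (hf : ∀ y ∈ dirs f, ∀ c, p ∣ (line f y c).card) (hf0 : f 0 = 0)
    {y c : F} (h : (line f y c).Nonempty) : (line f y c).card = (line f y 0).card := by
  obtain ⟨a, ha⟩ := h
  rw [mem_line] at ha
  subst ha
  rw [← rootMultiplicity_coeff_one_redei hf a y, rootMultiplicity_coeff_one_redei hf 0 y]
  simp [hf0]

end Lines

section Lacunary

variable {F : Type*} [Field F] {p : ℕ} [Fact p.Prime] [CharP F p]

theorem exists_eq_pow_of_pow_add_X_eq {g : F[X]} {e : ℕ} {c : F} (he : 0 < e)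
    (hd : 0 < g.natDegree) (hc : c ≠ 0) (h0 : g.coeff 0 = 0)
    (h : g ^ p ^ e + X = C c * (X ^ (p ^ e * g.natDegree) + g)) {i : ℕ} (hi : g.coeff i ≠ 0) :
    ∃ j, i = (p ^ e) ^ j := by
  have hs : 1 < p ^ e := Nat.one_lt_pow he.ne' (Fact.out : p.Prime).one_lt
  have hcoeff (k : ℕ) := congrArg (fun P => P.coeff k) h
  simp only [coeff_add, coeff_C_mul, coeff_X_pow, coeff_X] at hcoeff
  induction i using Nat.strong_induction_on with
  | _ i ih =>
    have hid : i ≤ g.natDegree := le_natDegree_of_ne_zero hi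
    by_cases h1 : i = 1
    · exact ⟨0, by simp [h1]⟩
    have hne : i ≠ p ^ e * g.natDegree := by nlinarith
    have hi' := hcoeff i
    rw [if_neg (Ne.symm h1), if_neg hne, add_zero, zero_add] at hi'
    by_cases hdvd : p ^ e ∣ i
    · obtain ⟨k, rfl⟩ := hdvd
      rw [coeff_pow_char_pow_mul] at hi'
      have hk : g.coeff k ≠ 0 := by
        intro hk
        rw [hk, zero_pow (by omega)] at hi'
        exact mul_ne_zero hc hi hi'.symm
      have hk0 : 0 < k := Nat.pos_of_ne_zero (by rintro rfl; exact hk h0)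
      obtain ⟨j, rfl⟩ := ih k (by nlinarith) hk
      exact ⟨j + 1, by rw [pow_succ']⟩
    · rw [coeff_pow_char_pow_of_not_dvd g hdvd] at hi'
      exact absurd hi'.symm (mul_ne_zero hc hi)

theorem exists_lacunary {h : F[X]} (hm : h.Monic) {e q : ℕ} (he : 0 < e)
    (hp : p ∣ h.natDegree) (hh : h.natDegree ≠ 0) (hq : q = p ^ e * h.natDegree)
    (hdvd : h ∣ X ^ q - X) {N : ℕ}
    (hcoeff : ∀ k, N ≤ k → k < q → k ≠ 1 → (h ^ p ^ e).coeff k = 0) :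
    ∃ g k : F[X], h = X ^ h.natDegree + g ∧ g ^ p ^ e + X = h * k ∧ 0 < g.natDegree ∧
      p ^ e * g.natDegree + 1 ≤ N ∧ h.natDegree + k.natDegree = p ^ e * g.natDegree ∧
      derivative g * k + h * derivative k = 1 := by
  have hpp : p.Prime := Fact.out
  have hs : 1 < p ^ e := Nat.one_lt_pow he.ne' hpp.one_lt
  have hh2 : 2 ≤ h.natDegree := hpp.two_le.trans (Nat.le_of_dvd (by omega) hp)
  set m := h.natDegree with hmdef
  obtain ⟨g, hg⟩ : ∃ g, h = X ^ m + g := ⟨h - X ^ m, by ring⟩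
  have hgm : g.natDegree < m := by
    have : g = h - X ^ m := by rw [hg]; ring
    have hdeg : g.degree < h.degree := by
      rw [this]
      refine degree_sub_lt_left ?_ hm.ne_zero (by rw [hm.leadingCoeff, leadingCoeff_X_pow])
      rw [degree_X_pow, degree_eq_natDegree hm.ne_zero]
    by_cases hg0 : g = 0
    · rw [hg0, natDegree_zero]; omega
    · exact natDegree_lt_natDegree hg0 hdeg
  have hpow : h ^ p ^ e = X ^ q + g ^ p ^ e := by
    rw [hg, add_pow_char_pow, ← pow_mul, hq, mul_comm m]
  obtain ⟨k, hk⟩ : h ∣ g ^ p ^ e + X := by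
    have h1 : h ∣ h ^ p ^ e := dvd_pow_self _ (by omega)
    have h2 := dvd_sub h1 hdvd
    rwa [hpow, show X ^ q + g ^ p ^ e - (X ^ q - X) = g ^ p ^ e + X by ring] at h2
  have hgpow : (g ^ p ^ e).natDegree = p ^ e * g.natDegree := natDegree_pow _ _
  have hne : g ^ p ^ e + X ≠ 0 := by
    intro h0
    have := congrArg natDegree (eq_neg_of_add_eq_zero_left h0)
    rw [hgpow, natDegree_neg, natDegree_X] at this
    have := Nat.eq_one_of_mul_eq_one_right this
    omega
  have hk0 : k ≠ 0 := by rintro rfl; exact hne (by rw [hk, mul_zero])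
  have hdegk : (g ^ p ^ e + X).natDegree = m + k.natDegree := by
    rw [hk, natDegree_mul hm.ne_zero hk0]
  have hg0 : 0 < g.natDegree := by
    by_contra hcon
    have h0 : (g ^ p ^ e).natDegree = 0 := by rw [hgpow]; simp; omega
    have := natDegree_add_le (g ^ p ^ e) X
    rw [h0, natDegree_X, hdegk] at this
    omega
  have hdeg2 : 2 ≤ p ^ e * g.natDegree := by nlinarith
  refine ⟨g, k, hg, hk, hg0, ?_, ?_, ?_⟩
  · by_contra hcon
    have := hcoeff (p ^ e * g.natDegree) (by omega) (by rw [hq]; gcongr) (by omega)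
    rw [coeff_pow_char_pow_mul, pow_eq_zero_iff (by omega)] at this
    rw [hg, coeff_add, coeff_X_pow, if_neg hgm.ne, zero_add, coeff_natDegree,
      leadingCoeff_eq_zero] at this
    rw [this, natDegree_zero] at hg0
    omega
  · rw [← hdegk, natDegree_add_eq_left_of_natDegree_lt, hgpow]
    rw [hgpow, natDegree_X]; omega
  · have hd := congrArg derivative hk
    have hder : derivative h = derivative g := by
      obtain ⟨r, hr⟩ := hp
      rw [hg, derivative_add, derivative_X_pow, hr]
      simp
    rw [derivative_add, derivative_X, derivative_pow, derivative_mul, hder] at hd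
    rw [← hd]
    simp [he.ne']

theorem lacunary_linearized {h : F[X]} (hm : h.Monic) {e q : ℕ} (he : 0 < e) (hs : 3 ≤ p ^ e)
    (hp : p ∣ h.natDegree) (hh : h.natDegree ≠ 0) (hq : q = p ^ e * h.natDegree)
    (hdvd : h ∣ X ^ q - X) (h0 : h.coeff 0 = 0) {N : ℕ}
    (hcoeff : ∀ k, N ≤ k → k < q → k ≠ 1 → (h ^ p ^ e).coeff k = 0)
    (hNq : N * (p ^ e - 1) ≤ q - 1) {i : ℕ} (hi : h.coeff i ≠ 0) :
    ∃ j, i = (p ^ e) ^ j := by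
  obtain ⟨g, k, hg, hgk, hgd, hgN, hdeg, hder⟩ := exists_lacunary hm he hp hh hq hdvd hcoeff
  have hk' : derivative k = 0 := by
    by_contra hne
    have h1 : h * derivative k = 1 - derivative g * k := by rw [← hder]; ring
    have h2 := congrArg natDegree h1
    rw [natDegree_mul hm.ne_zero hne] at h2
    have h3 : (1 - derivative g * k).natDegree ≤ g.natDegree - 1 + k.natDegree :=
      (natDegree_sub_le _ _).trans <| by
        rw [natDegree_one]
        exact max_le (Nat.zero_le _) <| natDegree_mul_le.trans
          (Nat.add_le_add_right (natDegree_derivative_le _) _)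
    obtain ⟨s, hs'⟩ : ∃ s, p ^ e = s + 1 := ⟨p ^ e - 1, by omega⟩
    rw [hs'] at hgN hdeg hNq hq hs
    have h4 : h.natDegree + 1 ≤ g.natDegree + k.natDegree := by omega
    have h5 : 0 < q := by rw [hq]; positivity
    obtain ⟨q', rfl⟩ : ∃ q', q = q' + 1 := ⟨q - 1, by omega⟩
    simp only [Nat.add_sub_cancel] at hNq
    have h6 : ((s + 1) * g.natDegree + 1) * s ≤ q' := (Nat.mul_le_mul_right _ hgN).trans hNq
    have h7 : s * g.natDegree + 1 ≤ h.natDegree := by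
      by_contra hcon
      have : h.natDegree ≤ s * g.natDegree := by omega
      nlinarith
    nlinarith
  rw [hk', mul_zero, add_zero] at hder
  obtain ⟨c, hc, rfl⟩ := Polynomial.isUnit_iff.mp (IsUnit.of_mul_eq_one_right _ hder)
  rw [natDegree_C, add_zero] at hdeg
  have hg' : g ^ p ^ e + X = C c * (X ^ (p ^ e * g.natDegree) + g) := by
    rw [← hdeg, ← hg, hgk, mul_comm]
  have hcoeffg {i : ℕ} := exists_eq_pow_of_pow_add_X_eq he hgd hc.ne_zero (i := i)
    (by rw [hg] at h0; simpa [hh, coeff_X_pow, Ne.symm hh] using h0) hg'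
  by_cases hi1 : i = h.natDegree
  · obtain ⟨j, hj⟩ := hcoeffg (i := g.natDegree) (by
      rw [coeff_natDegree, Ne, leadingCoeff_eq_zero]; rintro rfl; simp at hgd)
    exact ⟨j + 1, by rw [hi1, hdeg, pow_succ', ← hj]⟩
  · rw [hg, coeff_add, coeff_X_pow, if_neg hi1, zero_add] at hi
    exact hcoeffg hi

end Lacunary

section Values

variable {F : Type*} [Field F] [Fintype F] {f : F → F}

open Classical in
/-- The values of `x ↦ f x - y x`, i.e. the intercepts of the lines of slope `y` that meet the
graph of `f`. -/
noncomputable def values (f : F → F) (y : F) : Finset F := {c | (line f y c).Nonempty}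

theorem mem_values {y c : F} : c ∈ values f y ↔ ∃ x, f x - y * x = c := by
  simp only [values, Finset.mem_filter, Finset.mem_univ, true_and]
  exact exists_congr fun x => mem_line

/-- The monic polynomial whose roots are the values of `x ↦ f x - y x`, without multiplicity. -/
noncomputable def valuesPoly (f : F → F) (y : F) : F[X] := ∏ c ∈ values f y, (X - C c)

theorem monic_valuesPoly (y : F) : (valuesPoly f y).Monic := monic_prod_X_sub_C _ _

theorem natDegree_valuesPoly (y : F) : (valuesPoly f y).natDegree = (values f y).card := by
  rw [valuesPoly, natDegree_finsetProd_X_sub_C_eq_card]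

theorem eval_valuesPoly_eq_zero {y c : F} : (valuesPoly f y).eval c = 0 ↔ c ∈ values f y := by
  rw [valuesPoly, eval_prod, Finset.prod_eq_zero_iff]
  simp [sub_eq_zero]

theorem valuesPoly_dvd (y : F) : valuesPoly f y ∣ X ^ Fintype.card F - X := by
  rw [← prod_X_sub_C_univ]
  exact Finset.prod_dvd_prod_of_subset _ _ _ (Finset.subset_univ _)

theorem slopePoly_eq_valuesPoly_pow {p : ℕ} [Fact p.Prime] [CharP F p]
    (hf : ∀ y ∈ dirs f, ∀ c, p ∣ (line f y c).card) (hf0 : f 0 = 0) (y : F) :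
    slopePoly f y = valuesPoly f y ^ (line f y 0).card := by
  classical
  rw [slopePoly_eq_prod, valuesPoly, ← Finset.prod_pow]
  symm
  refine Finset.prod_subset_one_on_sdiff (Finset.subset_univ _) (fun c hc => ?_) fun c hc => ?_
  · simp only [values, Finset.mem_sdiff, Finset.mem_univ, Finset.mem_filter, true_and,
      Finset.not_nonempty_iff_eq_empty] at hc
    rw [hc, Finset.card_empty, pow_zero]
  · simp only [values, Finset.mem_filter, Finset.mem_univ, true_and] at hc
    rw [card_line_of_nonempty hf hf0 hc]

theorem card_line_mul_card_values {p : ℕ} [Fact p.Prime] [CharP F p]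
    (hf : ∀ y ∈ dirs f, ∀ c, p ∣ (line f y c).card) (hf0 : f 0 = 0) (y : F) :
    (line f y 0).card * (values f y).card = Fintype.card F := by
  rw [← natDegree_slopePoly (f := f) y, slopePoly_eq_valuesPoly_pow hf hf0, natDegree_pow,
    natDegree_valuesPoly]

theorem sum_card_line_sub_one (hf0 : f 0 = 0) :
    ∑ y ∈ dirs f, ((line f y 0).card - 1) = Fintype.card F - 1 := by
  classical
  rw [← Finset.card_univ, ← Finset.card_erase_of_mem (Finset.mem_univ (0 : F)),
    Finset.card_eq_sum_card_fiberwise (f := fun x => f x / x) (t := dirs f)]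
  · refine Finset.sum_congr rfl fun y _ => ?_
    rw [← Finset.card_erase_of_mem (a := 0) (by simp [mem_line, hf0])]
    congr 1
    ext x
    simp only [Finset.mem_erase, mem_line, Finset.mem_filter, Finset.mem_univ, and_true]
    refine and_congr_right fun hx => ?_
    rw [div_eq_iff hx, sub_eq_zero]
  · intro x hx
    have hx : x ≠ 0 := by simpa using hx
    refine mem_dirs.mpr ⟨x, 0, hx, ?_⟩
    simp [hf0, div_mul_cancel₀ _ hx]

end Values

section Linear

variable {F : Type*} [Field F] [Fintype F] {f : F → F}

theorem mem_span_graph_of_hyperplanes (K : Subfield F) (G : Finset F)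
    (hG : ∀ y ∈ G, ∃ ψ : Module.Dual K F, ψ ≠ 0 ∧ ∀ x, ψ (f x - y * x) = 0)
    (hcard : Nat.card F < Nat.card K * (1 + G.card * (Nat.card K - 1))) {v : F × F}
    (hv : v ∈ Submodule.span K (Set.range fun x => (x, f x))) : f v.1 = v.2 := by
  classical
  set W : Submodule K (F × F) := Submodule.span K (Set.range fun x => (x, f x)) with hW
  have hK : 1 < Nat.card K := Finite.one_lt_card
  choose! ψ hψ0 hψ using hG
  let Φ (y : F) : Module.Dual K (F × F) :=
    ψ y ∘ₗ (LinearMap.snd K F F - LinearMap.mulLeft K y ∘ₗ LinearMap.fst K F F)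
  have hΦ (y x z : F) : Φ y (x, z) = ψ y (z - y * x) := rfl
  have hΦW (y) (hy : y ∈ G) : Φ y ∈ W.dualAnnihilator := by
    rw [Submodule.mem_dualAnnihilator]
    intro w hw
    induction hw using Submodule.span_induction with
    | mem w hw => obtain ⟨x, rfl⟩ := hw; exact hψ y hy x
    | zero => exact map_zero _
    | add a b _ _ ha hb => rw [map_add, ha, hb, add_zero]
    | smul c a _ ha => rw [map_smul, ha, smul_zero]
  have hΦ0 (y) (hy : y ∈ G) : Φ y ≠ 0 := by
    intro h
    refine hψ0 y hy (LinearMap.ext fun z => ?_)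
    have := LinearMap.congr_fun h (0, z)
    rwa [hΦ, mul_zero, sub_zero] at this
  let ι : Option (G × Kˣ) → W.dualAnnihilator := fun o =>
    o.elim 0 fun a => ⟨a.2.1 • Φ a.1, Submodule.smul_mem _ _ (hΦW a.1 a.1.2)⟩
  have hι : Function.Injective ι := by
    rintro (_ | ⟨y, c⟩) (_ | ⟨y', c'⟩) h
    · rfl
    · exact absurd (congrArg Subtype.val h).symm (smul_ne_zero c'.ne_zero (hΦ0 y' y'.2))
    · exact absurd (congrArg Subtype.val h) (smul_ne_zero c.ne_zero (hΦ0 y y.2))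
    · have h1 : c.1 • Φ y = c'.1 • Φ y' := congrArg Subtype.val h
      have h2 (z : F) : c.1 • ψ y z = c'.1 • ψ y' z := by
        have := LinearMap.congr_fun h1 (0, z)
        simpa [hΦ] using this
      have hy : y = y' := by
        by_contra hne
        have hne' : (y' - y : F) ≠ 0 := sub_ne_zero.mpr fun h => hne (Subtype.ext h.symm)
        refine hψ0 y y.2 (LinearMap.ext fun z => ?_)
        have h3 := LinearMap.congr_fun h1 (z / (y' - y), 0)
        simp only [LinearMap.smul_apply, hΦ, ← h2] at h3
        have h4 := smul_right_injective K c.ne_zero h3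
        rw [← sub_eq_zero, ← map_sub] at h4
        rw [LinearMap.zero_apply, ← h4]
        congr 1
        field_simp
        ring
      subst hy
      have hc : c = c' := by
        obtain ⟨z, hz⟩ : ∃ z, ψ y z ≠ 0 := by
          by_contra! hcon
          exact hψ0 y y.2 (LinearMap.ext hcon)
        exact Units.ext (mul_right_cancel₀ hz (h2 z))
      rw [hc]
  have : Finite W.dualAnnihilator := Module.finite_of_finite K
  have hann : 1 + G.card * (Nat.card K - 1) ≤ Nat.card W.dualAnnihilator := by
    have := Nat.card_le_card_of_injective ι hι
    rwa [Finite.card_option, Nat.card_prod, Nat.card_eq_fintype_card, Fintype.card_coe,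
      Nat.card_units, add_comm] at this
  have hWF : Nat.card W ≤ Nat.card F := by
    have h1 := Subspace.finrank_add_finrank_dualAnnihilator_eq W
    rw [Module.finrank_prod] at h1
    have h2 : Nat.card F < Nat.card K * Nat.card W.dualAnnihilator :=
      hcard.trans_le (Nat.mul_le_mul_left _ hann)
    rw [Module.natCard_eq_pow_finrank (K := K) (V := F),
      Module.natCard_eq_pow_finrank (K := K) (V := W.dualAnnihilator), ← pow_succ',
      Nat.pow_lt_pow_iff_right hK] at h2
    rw [Module.natCard_eq_pow_finrank (K := K) (V := F),
      Module.natCard_eq_pow_finrank (K := K) (V := W)]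
    exact Nat.pow_le_pow_right hK.le (by omega)
  let j : F → W := fun x => ⟨(x, f x), Submodule.subset_span ⟨x, rfl⟩⟩
  have hj : Function.Injective j := fun a b h => congrArg (fun w : W => w.1.1) h
  obtain ⟨x, hx⟩ := (hj.bijective_of_nat_card_le hWF).2 ⟨v, hv⟩
  rw [← show (x, f x) = v from congrArg Subtype.val hx]

theorem linear_of_hyperplanes (K : Subfield F) (G : Finset F)
    (hG : ∀ y ∈ G, ∃ ψ : Module.Dual K F, ψ ≠ 0 ∧ ∀ x, ψ (f x - y * x) = 0)
    (hcard : Nat.card F < Nat.card K * (1 + G.card * (Nat.card K - 1))) :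
    (∀ x y, f (x + y) = f x + f y) ∧ ∀ c ∈ K, ∀ x, f (c * x) = c * f x := by
  have hmem (x : F) : (x, f x) ∈ Submodule.span K (Set.range fun x => (x, f x)) :=
    Submodule.subset_span ⟨x, rfl⟩
  exact ⟨fun x y => mem_span_graph_of_hyperplanes K G hG hcard (add_mem (hmem x) (hmem y)),
    fun c hc x => mem_span_graph_of_hyperplanes K G hG hcard
      (Submodule.smul_mem _ (⟨c, hc⟩ : K) (hmem x))⟩

end Linear

section Separable

variable {F : Type*} [Field F] [Fintype F] {f : F → F}

theorem slopePoly_dvd_mul_derivative (y : F) :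
    slopePoly f y ∣ (X ^ Fintype.card F - X) * derivative (slopePoly f y) := by
  classical
  rw [slopePoly, derivative_prod_finset, Finset.mul_sum]
  refine Finset.dvd_sum fun a _ => ?_
  rw [derivative_X_sub_C, mul_one, ← Finset.mul_prod_erase _ _ (Finset.mem_univ a)]
  refine mul_dvd_mul_right ?_ _
  rw [← prod_X_sub_C_univ]
  exact Finset.dvd_prod_of_mem (fun x => X - C x) (Finset.mem_univ _)

theorem derivative_slopePoly_ne_zero {p : ℕ} [CharP F p] {y c : F}
    (h : ¬ p ∣ (line f y c).card) : derivative (slopePoly f y) ≠ 0 := by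
  classical
  rw [slopePoly_eq_prod, ← Finset.mul_prod_erase _ _ (Finset.mem_univ c)]
  set Q := ∏ x ∈ Finset.univ.erase c, (X - C x) ^ (line f y x).card with hQ
  have hQc : Q.eval c ≠ 0 := by
    rw [hQ, eval_prod, Finset.prod_ne_zero_iff]
    intro x hx
    rw [eval_pow, eval_sub, eval_X, eval_C]
    exact pow_ne_zero _ (sub_ne_zero.mpr (Finset.ne_of_mem_erase hx).symm)
  obtain ⟨m, hm⟩ : ∃ m, (line f y c).card = m + 1 :=
    Nat.exists_eq_succ_of_ne_zero (by intro h0; rw [h0] at h; simp at h)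
  rw [hm] at h ⊢
  have key : derivative ((X - C c) ^ (m + 1) * Q) =
      (X - C c) ^ m * (C ((m + 1 : ℕ) : F) * Q + (X - C c) * derivative Q) := by
    rw [derivative_mul, derivative_X_sub_C_pow]
    simp only [Nat.add_sub_cancel, map_natCast]
    ring
  rw [key]
  refine mul_ne_zero (pow_ne_zero _ (X_sub_C_ne_zero c)) fun h0 => ?_
  have := congrArg (eval c) h0
  simp only [eval_add, eval_mul, eval_C, eval_sub, eval_X, sub_self, zero_mul, add_zero, eval_zero,
    mul_eq_zero, hQc, or_false] at this
  exact h ((CharP.cast_eq_zero_iff F p _).mp this)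

theorem slopePoly_ne_of_mem {y : F} (hy : y ∈ dirs f) :
    slopePoly f y ≠ X ^ Fintype.card F - X := by
  intro h
  obtain ⟨u, v, huv, h1⟩ := mem_dirs.mp hy
  have h2 : 1 < (line f y (f u - y * u)).card :=
    Finset.one_lt_card.mpr ⟨u, mem_line.mpr rfl, v, mem_line.mpr h1.symm, huv⟩
  have h3 : (X - C (f u - y * u)) ^ 2 ∣ slopePoly f y := by
    rw [slopePoly_eq_prod]
    exact (pow_dvd_pow _ h2).trans
      (Finset.dvd_prod_of_mem (fun c => (X - C c) ^ (line f y c).card) (Finset.mem_univ _))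
  obtain ⟨T, hT⟩ := h3
  generalize f u - y * u = c at hT
  have := congrArg (eval c) (congrArg derivative (hT.symm.trans h))
  simp [derivative_mul, derivative_X_sub_C_pow, derivative_X_pow] at this

theorem card_add_three_le_of_not_dvd {p : ℕ} [CharP F p] {y c : F} (hy : y ∈ dirs f)
    (h : ¬ p ∣ (line f y c).card) : Fintype.card F + 3 ≤ 2 * (dirs f).card := by
  set q := Fintype.card F with hq
  have hq1 : 1 < q := Fintype.one_lt_card
  obtain ⟨g, hg⟩ : ∃ g, slopePoly f y = X ^ q + g := ⟨slopePoly f y - X ^ q, by ring⟩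
  have hgdeg : g.natDegree ≤ max 1 ((dirs f).card - 1) := by
    refine natDegree_le_iff_coeff_eq_zero.mpr fun k hk => ?_
    rw [max_lt_iff] at hk
    have hc : (slopePoly f y).coeff k = (if k = q then 1 else 0) + g.coeff k := by
      rw [hg, coeff_add, coeff_X_pow]
    rcases lt_trichotomy k q with hkq | rfl | hkq
    · rw [coeff_slopePoly_eq_zero_of_card_dirs_le (by omega) hkq (by omega), if_neg hkq.ne,
        zero_add] at hc
      exact hc.symm
    · have h1 : (slopePoly f y).coeff q = 1 := by
        have := (monic_slopePoly (f := f) y).coeff_natDegree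
        rwa [natDegree_slopePoly] at this
      rw [h1, if_pos rfl] at hc
      simpa using hc
    · rw [coeff_eq_zero_of_natDegree_lt (by rw [natDegree_slopePoly]; exact hkq), if_neg hkq.ne',
        zero_add] at hc
      exact hc.symm
  have hder : derivative (slopePoly f y) = derivative g := by
    rw [hg, derivative_add, derivative_X_pow]
    simp [hq]
  have hg' : derivative g ≠ 0 := hder ▸ derivative_slopePoly_ne_zero h
  have hgX : g + X ≠ 0 := by
    intro h0
    refine slopePoly_ne_of_mem hy ?_
    rw [hg, eq_neg_of_add_eq_zero_left h0, sub_eq_add_neg]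
  have hdvd : slopePoly f y ∣ (g + X) * derivative g := by
    have h1 := slopePoly_dvd_mul_derivative (f := f) y
    have h2 : slopePoly f y ∣ slopePoly f y * derivative g := dvd_mul_right _ _
    rw [hder] at h1
    convert dvd_sub h2 h1 using 1
    rw [hg]
    ring
  have hle := natDegree_le_of_dvd hdvd (mul_ne_zero hgX hg')
  rw [natDegree_slopePoly, natDegree_mul hgX hg'] at hle
  have h1 : (g + X).natDegree ≤ max g.natDegree 1 := by
    simpa using natDegree_add_le g X
  have h2 := natDegree_derivative_le g
  omega

end Separable

section Subfield

variable {F : Type*} [Field F] {p : ℕ} [Fact p.Prime] [CharP F p]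

/-- The elements `c` with `c ^ p ^ e = c`. -/
def powFixed (F : Type*) [Field F] (p : ℕ) [Fact p.Prime] [CharP F p] (e : ℕ) : Subfield F :=
  (iterateFrobenius F p e).eqLocusField (RingHom.id F)

theorem mem_powFixed {e : ℕ} {c : F} : c ∈ powFixed F p e ↔ c ^ p ^ e = c := by
  change iterateFrobenius F p e c = c ↔ _
  rw [iterateFrobenius_def]

theorem natCard_powFixed [Fintype F] {e n : ℕ} (he : 0 < e) (hen : e ∣ n)
    (hF : Fintype.card F = p ^ n) : Nat.card (powFixed F p e) = p ^ e := by
  classical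
  have hs : 1 < p ^ e := Nat.one_lt_pow he.ne' (Fact.out : p.Prime).one_lt
  have hdvd : (X ^ p ^ e - X : F[X]) ∣ X ^ Fintype.card F - X := by
    obtain ⟨j, rfl⟩ := hen
    have hq : 1 ≤ p ^ (e * j) := Nat.one_le_pow _ _ (Fact.out : p.Prime).pos
    have h1 : p ^ e - 1 ∣ p ^ (e * j) - 1 := by
      have := Nat.sub_dvd_pow_sub_pow (p ^ e) 1 j
      rwa [one_pow, ← pow_mul] at this
    have h2 : ∀ m : ℕ, 1 ≤ m → (X ^ m - X : F[X]) = X * (X ^ (m - 1) - 1) := by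
      intro m hm
      obtain ⟨m, rfl⟩ := Nat.exists_eq_add_of_le' hm
      rw [Nat.add_sub_cancel, pow_succ']
      ring
    rw [hF, h2 _ hs.le, h2 _ hq]
    refine mul_dvd_mul_left _ ?_
    obtain ⟨t, ht⟩ := h1
    have := sub_dvd_pow_sub_pow (X ^ (p ^ e - 1) : F[X]) 1 t
    rwa [one_pow, ← pow_mul, ← ht] at this
  have hq0 : (X ^ Fintype.card F - X : F[X]) ≠ 0 :=
    FiniteField.X_pow_card_sub_X_ne_zero F Fintype.one_lt_card
  have hs0 : (X ^ p ^ e - X : F[X]) ≠ 0 := FiniteField.X_pow_card_sub_X_ne_zero F hs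
  have hnodup : (X ^ p ^ e - X : F[X]).roots.Nodup :=
    Multiset.nodup_of_le (roots.le_of_dvd hq0 hdvd)
      (by rw [FiniteField.roots_X_pow_card_sub_X]; exact Finset.univ.nodup)
  have hsplits : (X ^ p ^ e - X : F[X]).Splits := by
    refine Splits.of_dvd ?_ hq0 hdvd
    rw [← prod_X_sub_C_univ]
    exact Splits.prod fun x _ => Splits.X_sub_C x
  have hset : ((powFixed F p e : Subfield F) : Set F) =
      ((X ^ p ^ e - X : F[X]).roots.toFinset : Set F) := by
    ext c
    simp [mem_powFixed, hs0, sub_eq_zero]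
  calc Nat.card (powFixed F p e) = Nat.card ((powFixed F p e : Subfield F) : Set F) := rfl
    _ = (X ^ p ^ e - X : F[X]).roots.toFinset.card := by
        rw [hset, Nat.card_coe_set_eq, Set.ncard_coe_finset]
    _ = p ^ e := by
        rw [Multiset.toFinset_card_of_nodup hnodup, ← hsplits.natDegree_eq_card_roots,
          FiniteField.X_pow_card_sub_X_natDegree_eq _ hs]

theorem pow_pow_of_mem_powFixed {e : ℕ} {c : F} (hc : c ∈ powFixed F p e) (j : ℕ) :
    c ^ (p ^ e) ^ j = c := by
  rw [mem_powFixed] at hc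
  induction j with
  | zero => simp
  | succ j ih => rw [pow_succ, pow_mul, ih, hc]

theorem eval_add_of_linearized {h : F[X]} {e : ℕ}
    (hh : ∀ i, h.coeff i ≠ 0 → ∃ j, i = (p ^ e) ^ j) (x y : F) :
    h.eval (x + y) = h.eval x + h.eval y := by
  simp only [eval_eq_sum, sum_def]
  rw [← Finset.sum_add_distrib]
  refine Finset.sum_congr rfl fun i hi => ?_
  obtain ⟨j, rfl⟩ := hh i (mem_support_iff.mp hi)
  rw [← pow_mul, add_pow_char_pow, mul_add]

theorem eval_mul_of_linearized {h : F[X]} {e : ℕ}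
    (hh : ∀ i, h.coeff i ≠ 0 → ∃ j, i = (p ^ e) ^ j) {c : F} (hc : c ∈ powFixed F p e) (x : F) :
    h.eval (c * x) = c * h.eval x := by
  simp only [eval_eq_sum, sum_def]
  rw [Finset.mul_sum]
  refine Finset.sum_congr rfl fun i hi => ?_
  obtain ⟨j, rfl⟩ := hh i (mem_support_iff.mp hi)
  rw [mul_pow, pow_pow_of_mem_powFixed hc]
  ring

end Subfield

section Classification

variable {F : Type*} [Field F] [Fintype F] {f : F → F} {p e n : ℕ}

theorem dvd_of_pow_dvd (he0 : 0 < e) (he : ∀ y ∈ dirs f, ∀ c, p ^ e ∣ (line f y c).card) :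
    ∀ y ∈ dirs f, ∀ c, p ∣ (line f y c).card :=
  fun y hy c => (dvd_pow_self p he0.ne').trans (he y hy c)

theorem card_line_zero_pos (hf0 : f 0 = 0) (y : F) : 0 < (line f y 0).card :=
  Finset.card_pos.mpr ⟨0, by simp [mem_line, hf0]⟩

theorem card_dirs_mul_le (hf0 : f 0 = 0)
    (he : ∀ y ∈ dirs f, ∀ c, p ^ e ∣ (line f y c).card) :
    (dirs f).card * (p ^ e - 1) ≤ Fintype.card F - 1 := by
  rw [← sum_card_line_sub_one hf0, ← smul_eq_mul]
  exact Finset.card_nsmul_le_sum _ _ _ fun y hy => Nat.sub_le_sub_right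
    (Nat.le_of_dvd (card_line_zero_pos hf0 y) (he y hy 0)) 1

theorem exists_eq_mul_of_card_dvd (hf0 : f 0 = 0)
    (he : ∀ y ∈ dirs f, ∀ c, Fintype.card F ∣ (line f y c).card) :
    ∃ m, (∀ x, f x = m * x) ∧ dirs f = {m} := by
  obtain ⟨m, hm⟩ := dirs_nonempty (f := f)
  have h1 : line f m 0 = Finset.univ := Finset.eq_univ_of_card _ <|
    le_antisymm (Finset.card_le_univ _) (Nat.le_of_dvd (card_line_zero_pos hf0 m) (he m hm 0))
  have h2 (x : F) : f x = m * x := by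
    have : x ∈ line f m 0 := h1 ▸ Finset.mem_univ x
    exact sub_eq_zero.mp (mem_line.mp this)
  refine ⟨m, h2, Finset.eq_singleton_iff_unique_mem.mpr ⟨hm, fun y hy => ?_⟩⟩
  obtain ⟨u, v, huv, h⟩ := mem_dirs.mp hy
  rw [h2, h2] at h
  have h3 : (m - y) * (u - v) = 0 := by linear_combination h
  exact (sub_eq_zero.mp ((mul_eq_zero.mp h3).resolve_right (sub_ne_zero.mpr huv))).symm

theorem card_lt_of_three_le [Fact p.Prime] (hF : Fintype.card F = p ^ n) (hf0 : f 0 = 0)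
    (hen : e < n) (hs : 3 ≤ p ^ e) (he : ∀ y ∈ dirs f, ∀ c, p ^ e ∣ (line f y c).card)
    (hN : p ^ (n - e) + 1 ≤ (dirs f).card) :
    Fintype.card F <
      p ^ e * (1 + ((dirs f).filter fun y => (line f y 0).card = p ^ e).card * (p ^ e - 1)) := by
  have hsum := sum_card_line_sub_one hf0
  rw [← Finset.sum_filter_add_sum_filter_not _ fun y => (line f y 0).card = p ^ e] at hsum
  have hcard := Finset.card_filter_add_card_filter_not (s := dirs f)
    fun y => (line f y 0).card = p ^ e
  set A := (dirs f).filter fun y => (line f y 0).card = p ^ e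
  set B := (dirs f).filter fun y => ¬ (line f y 0).card = p ^ e
  have hA : A.card * (p ^ e - 1) ≤ ∑ y ∈ A, ((line f y 0).card - 1) := by
    rw [← smul_eq_mul]
    refine Finset.card_nsmul_le_sum _ _ _ fun y hy => ?_
    rw [(Finset.mem_filter.mp hy).2]
  have hB : B.card * (2 * p ^ e - 1) ≤ ∑ y ∈ B, ((line f y 0).card - 1) := by
    rw [← smul_eq_mul]
    refine Finset.card_nsmul_le_sum _ _ _ fun y hy => ?_
    obtain ⟨hy, hne⟩ := Finset.mem_filter.mp hy
    obtain ⟨t, ht⟩ := he y hy 0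
    have hpos := card_line_zero_pos hf0 y
    rw [ht] at hpos hne ⊢
    have : 2 ≤ t := by
      rcases t with _ | _ | t
      · simp at hpos
      · simp at hne
      · omega
    exact Nat.sub_le_sub_right (by nlinarith) 1
  have hq : Fintype.card F = p ^ e * p ^ (n - e) := by
    rw [hF, ← pow_add, Nat.add_sub_of_le hen.le]
  have hm : 0 < p ^ (n - e) := Nat.pow_pos (Fact.out : p.Prime).pos
  rw [hq] at hsum ⊢
  generalize p ^ (n - e) = m at *
  obtain ⟨s, hs'⟩ : ∃ s, p ^ e = s + 1 := ⟨p ^ e - 1, by omega⟩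
  rw [hs'] at hA hB hsum ⊢
  rw [show 2 * (s + 1) - 1 = 2 * s + 1 by omega] at hB
  simp only [Nat.add_sub_cancel] at hA hsum ⊢
  have h1 : A.card * s + B.card * (2 * s + 1) + 1 ≤ (s + 1) * m := by
    have : 0 < (s + 1) * m := by positivity
    omega
  have h2 : B.card * (s + 1) + (s + 1) ≤ m := by nlinarith
  have h3 : 3 * B.card + 3 ≤ m := by nlinarith
  refine Nat.mul_lt_mul_of_pos_left ?_ (Nat.succ_pos s)
  nlinarith

variable [Fact p.Prime] [CharP F p]

theorem exists_card_line_eq (hF : Fintype.card F = p ^ n) (hf0 : f 0 = 0) (he0 : 0 < e)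
    (he : ∀ y ∈ dirs f, ∀ c, p ^ e ∣ (line f y c).card)
    (hmax : ∃ y ∈ dirs f, ∃ c, ¬ p ^ (e + 1) ∣ (line f y c).card) :
    ∃ y ∈ dirs f, (line f y 0).card = p ^ e := by
  have hp : p.Prime := Fact.out
  have hf := dvd_of_pow_dvd he0 he
  obtain ⟨y, hy, c, hc⟩ := hmax
  refine ⟨y, hy, ?_⟩
  have hne : (line f y c).Nonempty := by
    rw [Finset.nonempty_iff_ne_empty]
    intro h
    simp [h] at hc
  rw [card_line_of_nonempty hf hf0 hne] at hc
  have h1 : (line f y 0).card ∣ p ^ n := by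
    rw [← hF, ← card_line_mul_card_values hf hf0 y]
    exact dvd_mul_right _ _
  obtain ⟨i, -, hi⟩ := (Nat.dvd_prime_pow hp).mp h1
  have h2 := he y hy 0
  rw [hi, Nat.pow_dvd_pow_iff_le_right hp.one_lt] at hc h2
  rw [hi, show i = e by omega]

theorem card_values_of_card_line_eq (hF : Fintype.card F = p ^ n) (hf0 : f 0 = 0) (he0 : 0 < e)
    (hen : e < n) (he : ∀ y ∈ dirs f, ∀ c, p ^ e ∣ (line f y c).card) {y : F}
    (hy : (line f y 0).card = p ^ e) : (values f y).card = p ^ (n - e) := by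
  have h := card_line_mul_card_values (dvd_of_pow_dvd he0 he) hf0 y
  rw [hy, hF, ← Nat.add_sub_of_le hen.le, pow_add] at h
  simpa using Nat.eq_of_mul_eq_mul_left (Nat.pow_pos (Fact.out : p.Prime).pos) h

theorem coeff_valuesPoly_pow_eq_zero (hf0 : f 0 = 0) (he0 : 0 < e)
    (he : ∀ y ∈ dirs f, ∀ c, p ^ e ∣ (line f y c).card) {y : F} (hy : (line f y 0).card = p ^ e)
    (k : ℕ) (hk : (dirs f).card ≤ k) (hkq : k < Fintype.card F) (hk1 : k ≠ 1) :
    (valuesPoly f y ^ p ^ e).coeff k = 0 := by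
  rw [← hy, ← slopePoly_eq_valuesPoly_pow (dvd_of_pow_dvd he0 he) hf0]
  exact coeff_slopePoly_eq_zero_of_card_dirs_le hk1 hkq hk y

theorem card_dirs_lower_bound (hF : Fintype.card F = p ^ n) (hf0 : f 0 = 0) (he0 : 0 < e)
    (hen : e < n) (he : ∀ y ∈ dirs f, ∀ c, p ^ e ∣ (line f y c).card) {y : F}
    (hy : (line f y 0).card = p ^ e) : p ^ (n - e) + 1 ≤ (dirs f).card := by
  have hp : p.Prime := Fact.out
  have hdeg : (valuesPoly f y).natDegree = p ^ (n - e) := by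
    rw [natDegree_valuesPoly, card_values_of_card_line_eq hF hf0 he0 hen he hy]
  obtain ⟨g, k, -, -, -, hN, hdeg', -⟩ := exists_lacunary (monic_valuesPoly (f := f) y) he0
    (by rw [hdeg]; exact dvd_pow_self p (by omega)) (by rw [hdeg]; exact (Nat.pow_pos hp.pos).ne')
    (q := Fintype.card F) (by rw [hdeg, hF, ← pow_add, Nat.add_sub_of_le hen.le])
    (valuesPoly_dvd y) (coeff_valuesPoly_pow_eq_zero hf0 he0 he hy)
  omega

theorem coeff_valuesPoly_ne_zero (hF : Fintype.card F = p ^ n) (hf0 : f 0 = 0) (he0 : 0 < e)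
    (hen : e < n) (hs : 3 ≤ p ^ e) (he : ∀ y ∈ dirs f, ∀ c, p ^ e ∣ (line f y c).card) {y : F}
    (hy : (line f y 0).card = p ^ e) (i : ℕ) (hi : (valuesPoly f y).coeff i ≠ 0) :
    ∃ j, i = (p ^ e) ^ j := by
  have hp : p.Prime := Fact.out
  have hdeg : (valuesPoly f y).natDegree = p ^ (n - e) := by
    rw [natDegree_valuesPoly, card_values_of_card_line_eq hF hf0 he0 hen he hy]
  refine lacunary_linearized (monic_valuesPoly (f := f) y) he0 hs
    (by rw [hdeg]; exact dvd_pow_self p (by omega)) (by rw [hdeg]; exact (Nat.pow_pos hp.pos).ne')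
    (q := Fintype.card F) (by rw [hdeg, hF, ← pow_add, Nat.add_sub_of_le hen.le])
    (valuesPoly_dvd y) ?_ (coeff_valuesPoly_pow_eq_zero hf0 he0 he hy) (card_dirs_mul_le hf0 he) hi
  rw [coeff_zero_eq_eval_zero, eval_valuesPoly_eq_zero, mem_values]
  exact ⟨0, by simp [hf0]⟩

theorem dvd_of_card_line_eq (hF : Fintype.card F = p ^ n) (hf0 : f 0 = 0) (he0 : 0 < e)
    (hen : e < n) (hs : 3 ≤ p ^ e) (he : ∀ y ∈ dirs f, ∀ c, p ^ e ∣ (line f y c).card) {y : F}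
    (hy : (line f y 0).card = p ^ e) : e ∣ n := by
  have hdeg : (valuesPoly f y).natDegree = p ^ (n - e) := by
    rw [natDegree_valuesPoly, card_values_of_card_line_eq hF hf0 he0 hen he hy]
  obtain ⟨j, hj⟩ := coeff_valuesPoly_ne_zero hF hf0 he0 hen hs he hy (p ^ (n - e)) (by
    rw [← hdeg, (monic_valuesPoly y).coeff_natDegree]; exact one_ne_zero)
  rw [← pow_mul] at hj
  have : n - e = e * j := Nat.pow_right_injective (Fact.out : p.Prime).two_le hj
  exact ⟨j + 1, by rw [mul_add, mul_one]; omega⟩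

theorem exists_dual_of_card_line_eq (hF : Fintype.card F = p ^ n) (hf0 : f 0 = 0) (he0 : 0 < e)
    (hen : e < n) (hs : 3 ≤ p ^ e) (he : ∀ y ∈ dirs f, ∀ c, p ^ e ∣ (line f y c).card) {y : F}
    (hy : (line f y 0).card = p ^ e) :
    ∃ ψ : Module.Dual (powFixed F p e) F, ψ ≠ 0 ∧ ∀ x, ψ (f x - y * x) = 0 := by
  have hp : p.Prime := Fact.out
  have hlin := coeff_valuesPoly_ne_zero hF hf0 he0 hen hs he hy
  let V : Submodule (powFixed F p e) F :=
    { carrier := values f y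
      zero_mem' := Finset.mem_coe.mpr (mem_values.mpr ⟨0, by simp [hf0]⟩)
      add_mem' := by
        intro a b ha hb
        rw [Finset.mem_coe, ← eval_valuesPoly_eq_zero] at ha hb ⊢
        rw [eval_add_of_linearized hlin, ha, hb, add_zero]
      smul_mem' := by
        intro c a ha
        rw [Finset.mem_coe, ← eval_valuesPoly_eq_zero] at ha ⊢
        rw [Subfield.smul_def, smul_eq_mul, eval_mul_of_linearized hlin c.2, ha, mul_zero] }
  have hV : V < ⊤ := by
    rw [lt_top_iff_ne_top]
    intro h
    have h1 : values f y = Finset.univ := by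
      ext x
      have : x ∈ V := h ▸ Submodule.mem_top
      exact iff_of_true this (Finset.mem_univ x)
    have h2 := card_values_of_card_line_eq hF hf0 he0 hen he hy
    rw [h1, Finset.card_univ, hF] at h2
    have := Nat.pow_right_injective hp.two_le h2
    omega
  obtain ⟨ψ, hψ, hVψ⟩ := Submodule.exists_le_ker_of_lt_top V hV
  exact ⟨ψ, hψ, fun x => hVψ (show _ ∈ values f y from mem_values.mpr ⟨x, rfl⟩)⟩

theorem linear_of_three_le (hF : Fintype.card F = p ^ n) (hf0 : f 0 = 0) (he0 : 0 < e)
    (hen : e < n) (hs : 3 ≤ p ^ e) (he : ∀ y ∈ dirs f, ∀ c, p ^ e ∣ (line f y c).card)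
    {y : F} (hy : (line f y 0).card = p ^ e) :
    (∀ x y, f (x + y) = f x + f y) ∧ ∀ c ∈ powFixed F p e, ∀ x, f (c * x) = c * f x := by
  refine linear_of_hyperplanes (powFixed F p e)
    ((dirs f).filter fun y => (line f y 0).card = p ^ e) (fun y hy => ?_) ?_
  · exact exists_dual_of_card_line_eq hF hf0 he0 hen hs he (Finset.mem_filter.mp hy).2
  · rw [natCard_powFixed he0 (dvd_of_card_line_eq hF hf0 he0 hen hs he hy) hF,
      Nat.card_eq_fintype_card]
    exact card_lt_of_three_le hF hf0 hen hs he (card_dirs_lower_bound hF hf0 he0 hen he hy)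

end Classification

end Directions

open Directions in
/-- Ball–Blokhuis–Brouwer–Storme–Szőnyi, 1999: classification of the possible numbers
of directions determined by a function `f : GF(q) → GF(q)` with `f 0 = 0`, `q = p^n`. -/
theorem directions_classification (p n : ℕ) (hp : p.Prime) (hn : 0 < n)
    (F : Type) [Field F] [Fintype F] (hF : Fintype.card F = p ^ n)
    (f : F → F) (hf0 : f 0 = 0)
    (D : Set F) (hD : D = {m : F | ∃ u v : F, u ≠ v ∧ m = (f u - f v) / (u - v)})
    (N : ℕ) (hN : N = D.ncard)
    (e : ℕ) (hen : e ≤ n)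
    (he : ∀ m ∈ D, ∀ c : F, p ^ e ∣ Set.ncard {x : F | f x = m * x + c})
    (hemax : ∀ e' : ℕ, e' ≤ n →
      (∀ m ∈ D, ∀ c : F, p ^ e' ∣ Set.ncard {x : F | f x = m * x + c}) → e' ≤ e) :
    ((e = 0 ∧ ((p : ℚ) ^ n + 3) / 2 ≤ (N : ℚ) ∧ N ≤ p ^ n + 1) ∨
     (e = 1 ∧ p = 2 ∧ ((p : ℚ) ^ n + 5) / 3 ≤ (N : ℚ) ∧ N ≤ p ^ n - 1) ∨
     (p ^ e > 2 ∧ e ∣ n ∧ ((p : ℚ) ^ n / (p : ℚ) ^ e + 1 ≤ (N : ℚ)) ∧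
        (N : ℚ) ≤ ((p : ℚ) ^ n - 1) / ((p : ℚ) ^ e - 1)) ∨
     (e = n ∧ N = 1)) ∧
    ((p ^ e > 3 ∨ (p ^ e = 3 ∧ (N : ℚ) = (p : ℚ) ^ n / 3 + 1)) →
      (∀ x y : F, f (x + y) = f x + f y) ∧
      (∀ c x : F, c ^ (p ^ e) = c → f (c * x) = c * f x)) := by
  have : Fact p.Prime := ⟨hp⟩
  have : CharP F p := charP_of_card_eq_prime_pow hF
  obtain rfl : D = dirs f := by ext m; simp [hD, dirs]
  have hline (m c : F) : Set.ncard {x : F | f x = m * x + c} = (line f m c).card := by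
    rw [← Set.ncard_coe_finset]
    congr 1
    ext x
    simp [line]
  rw [Set.ncard_coe_finset] at hN
  simp only [hline, Finset.mem_coe] at he hemax
  rcases hen.eq_or_lt with rfl | hlt
  · rw [← hF] at he
    obtain ⟨m, hm, hdirs⟩ := exists_eq_mul_of_card_dvd hf0 he
    refine ⟨Or.inr (Or.inr (Or.inr ⟨rfl, by rw [hN, hdirs, Finset.card_singleton]⟩)), fun _ => ?_⟩
    exact ⟨fun x y => by simp only [hm, mul_add], fun c x _ => by simp only [hm]; ring⟩
  have hmax : ∃ y ∈ dirs f, ∃ c, ¬ p ^ (e + 1) ∣ (line f y c).card := by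
    by_contra! hcon
    have := hemax (e + 1) hlt hcon
    omega
  rcases Nat.eq_zero_or_pos e with rfl | he0
  · refine ⟨Or.inl ⟨rfl, ?_, ?_⟩, fun h => by simp at h⟩
    · obtain ⟨y, hy, c, hc⟩ := hmax
      rw [zero_add, pow_one] at hc
      have h1 := card_add_three_le_of_not_dvd hy hc
      rw [← hN, hF] at h1
      have h2 : (p : ℚ) ^ n + 3 ≤ 2 * N := by exact_mod_cast h1
      linarith
    · rw [hN, ← hF]
      exact (Finset.card_le_univ _).trans (Nat.le_succ _)
  obtain ⟨y, hy, hys⟩ := exists_card_line_eq hF hf0 he0 he hmax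
  have hlower := card_dirs_lower_bound hF hf0 he0 hlt he hys
  have hupper := card_dirs_mul_le hf0 he
  have hq : p ^ n = p ^ e * p ^ (n - e) := by rw [← pow_add, Nat.add_sub_of_le hen]
  have hs2 : 2 ≤ p ^ e := hp.two_le.trans (Nat.le_self_pow he0.ne' p)
  have hm2 : 2 ≤ p ^ (n - e) := hp.two_le.trans (Nat.le_self_pow (by omega) p)
  rw [← hN] at hlower hupper
  rw [hF] at hupper
  rcases hs2.eq_or_lt with hs | hs
  · have hp2 : p = 2 := (Nat.prime_dvd_prime_iff_eq hp Nat.prime_two).mp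
      (hs ▸ dvd_pow_self p he0.ne')
    have he1 : e = 1 := by
      rw [hp2] at hs
      exact (Nat.pow_right_injective le_rfl (hs.symm.trans (pow_one 2).symm))
    refine ⟨Or.inr (Or.inl ⟨he1, hp2, ?_, ?_⟩), fun h => by omega⟩
    · have h1 : p ^ n + 5 ≤ 3 * N := by
        rw [hq, ← hs]
        omega
      have h2 : (p : ℚ) ^ n + 5 ≤ 3 * N := by exact_mod_cast h1
      linarith
    · rw [← hs] at hupper
      simpa using hupper
  · refine ⟨Or.inr (Or.inr (Or.inl ⟨hs, dvd_of_card_line_eq hF hf0 he0 hlt hs he hys, ?_, ?_⟩)),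
      fun _ => ?_⟩
    · have h1 : (p : ℚ) ^ n = p ^ e * p ^ (n - e) := by exact_mod_cast hq
      have h0 : (p : ℚ) ^ e ≠ 0 := pow_ne_zero _ (by exact_mod_cast hp.ne_zero)
      rw [h1, mul_div_cancel_left₀ _ h0]
      exact_mod_cast hlower
    · have h1 : (2 : ℚ) < (p : ℚ) ^ e := by exact_mod_cast hs
      rw [le_div_iff₀ (by linarith)]
      have h2 : ((N * (p ^ e - 1) : ℕ) : ℚ) ≤ ((p ^ n - 1 : ℕ) : ℚ) := by exact_mod_cast hupper
      have h3 : 1 ≤ p ^ n := Nat.one_le_pow _ _ hp.pos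
      rw [Nat.cast_mul, Nat.cast_sub (by omega), Nat.cast_sub h3] at h2
      exact_mod_cast h2
    · obtain ⟨hadd, hmul⟩ := linear_of_three_le hF hf0 he0 hlt hs he hys
      exact ⟨hadd, fun c x hc => hmul c (mem_powFixed.mpr hc) x⟩
end

section
/- Let p be a prime and let B be a blocking set in PG(2,p) that does not contain all the points of any line. Then 2·|B| ≥ 3(p+1), i.e., |B| ≥ 3(p+1)/2. -/
open Module

open Polynomial in
/-- In characteristic `p`, the Wronskian of two nonzero polynomials of distinct degrees
less than `p` does not vanish. -/
theorem wronskian_ne_zero_of_natDegree_lt {F : Type*} [Field F] {p : ℕ} [CharP F p]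
    {g h : F[X]} (hg : g ≠ 0) (hh : h ≠ 0) (hlt : h.natDegree < g.natDegree)
    (hgp : g.natDegree < p) : wronskian h g ≠ 0 := by
  intro hW
  have natDegree_X_mul_derivative_le (a : F[X]) : (X * derivative a).natDegree ≤ a.natDegree := by
    refine natDegree_le_iff_coeff_eq_zero.2 fun N hN => ?_
    cases N with
    | zero => simp
    | succ N => simp [coeff_X_mul, coeff_derivative, coeff_eq_zero_of_natDegree_lt hN]
  have coeff_X_mul_derivative (a : F[X]) (n : ℕ) :
      (X * derivative a).coeff n = n * a.coeff n := by
    cases n with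
    | zero => simp
    | succ N => simp [coeff_X_mul, coeff_derivative, mul_comm]
  have hzero : h * (X * derivative g) = (X * derivative h) * g := by
    rw [wronskian] at hW
    linear_combination X * hW
  have hcoeff := congrArg (fun q => q.coeff (h.natDegree + g.natDegree)) hzero
  rw [coeff_mul_add_eq_of_natDegree_le le_rfl (natDegree_X_mul_derivative_le g),
    coeff_mul_add_eq_of_natDegree_le (natDegree_X_mul_derivative_le h) le_rfl,
    coeff_X_mul_derivative, coeff_X_mul_derivative] at hcoeff
  have hgl : g.coeff g.natDegree ≠ 0 := leadingCoeff_ne_zero.2 hg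
  have hhl : h.coeff h.natDegree ≠ 0 := leadingCoeff_ne_zero.2 hh
  have hdeg : (g.natDegree : F) = h.natDegree :=
    mul_right_cancel₀ (mul_ne_zero hgl hhl) (by linear_combination hcoeff)
  rw [CharP.natCast_eq_natCast F p] at hdeg
  exact hlt.ne' (hdeg.eq_of_lt_of_lt hgp (hlt.trans hgp))

open Polynomial in
/-- A lacunary polynomial `(X ^ p + c) g + h` over the prime field that splits completely
has `h = 0` as soon as `deg h < deg g ≤ p / 2`. -/
theorem lacunary_remainder_eq_zero {F : Type*} [Field F] [Fintype F] {p : ℕ} [CharP F p]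
    (hF : Fintype.card F = p) {f g h : F[X]} {c : F} (hf : f.Splits) (hg : g ≠ 0)
    (hfgh : f = (X ^ p + C c) * g + h) (hlt : h.natDegree < g.natDegree)
    (hgp : 2 * g.natDegree ≤ p) : h = 0 := by
  classical
  by_contra hh
  have hp : 1 < p := hF ▸ Fintype.one_lt_card
  have hW := wronskian_ne_zero_of_natDegree_lt hg hh hlt (by omega : g.natDegree < p)
  set A : F[X] := (X + C c) * g + h with hA
  have hdegA : A.natDegree = g.natDegree + 1 := by
    have h1 : ((X + C c) * g).natDegree = g.natDegree + 1 := by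
      rw [natDegree_mul (X_add_C_ne_zero c) hg, natDegree_X_add_C, add_comm]
    rw [hA, natDegree_add_eq_left_of_natDegree_lt (by omega), h1]
  have hdegf : f.natDegree = p + g.natDegree := by
    have h1 : ((X ^ p + C c) * g).natDegree = p + g.natDegree := by
      rw [natDegree_mul (X_pow_add_C_ne_zero (by omega) c) hg, natDegree_X_pow_add_C]
    rw [hfgh, natDegree_add_eq_left_of_natDegree_lt (by omega), h1]
  have hA0 : A ≠ 0 := by
    intro h0
    simp [h0] at hdegA
  have hf0 : f ≠ 0 := by
    intro h0
    simp [h0] at hdegf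
    omega
  have hdvd : f ∣ A * wronskian h g := by
    refine hf.dvd_of_roots_le_roots hf0 (Multiset.le_iff_count.2 fun a => ?_)
    rw [count_roots, count_roots, le_rootMultiplicity_iff (mul_ne_zero hA0 hW)]
    have hpow := pow_rootMultiplicity_dvd f a
    generalize rootMultiplicity a f = m at hpow
    cases m with
    | zero => simp
    | succ m =>
      rw [pow_succ'] at hpow ⊢
      refine mul_dvd_mul ?_ ?_
      · have hroot := (dvd_mul_right _ _).trans hpow
        rw [dvd_iff_isRoot, IsRoot.def] at hroot ⊢
        have ha : a ^ p = a := by rw [← hF, FiniteField.pow_card]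
        simpa [hfgh, hA, ha] using hroot
      · have hder : (X - C a) ^ m ∣ derivative f :=
          pow_sub_one_dvd_derivative_of_pow_dvd (n := m + 1) (by rwa [pow_succ'])
        have hWf : wronskian h g = f * derivative g - derivative f * g := by
          have : derivative f = (X ^ p + C c) * derivative g + derivative h := by
            simp [hfgh, derivative_X_pow]
          rw [wronskian, this, hfgh]
          ring
        rw [hWf]
        exact dvd_sub (((dvd_mul_left _ _).trans hpow).mul_right _) (hder.mul_right _)
  have hle := natDegree_le_of_dvd hdvd (mul_ne_zero hA0 hW)
  rw [natDegree_mul hA0 hW, hdegA, hdegf] at hle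
  have := natDegree_wronskian_lt_add hW
  omega

open Polynomial in
/-- The lacunary structure of the Rédei polynomial (at infinity) of an affine point set meeting
all non-vertical lines. -/
theorem redei_lacunary {F : Type*} [Field F] [Fintype F] (U : Finset (F × F))
    (hU : ∀ m c : F, ∃ u ∈ U, u.2 = m * u.1 + c) :
    Fintype.card F ≤ U.card ∧ ∀ j, U.card < Fintype.card F + j → j < Fintype.card F →
      (∏ u ∈ U, (X + C u.1)).coeff j = 0 := by
  set q := Fintype.card F with hq
  have hq1 : 1 < q := Fintype.one_lt_card
  have hnat (r : F × F → F) : (∏ u ∈ U, (X + C (r u))).natDegree = U.card := by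
    rw [natDegree_prod_of_monic _ _ fun u _ => monic_X_add_C _]
    simp
  have hmonic (r : F × F → F) : (∏ u ∈ U, (X + C (r u))).Monic :=
    monic_prod_of_monic _ _ fun u _ => monic_X_add_C _
  have hdvd (s : F) : (X ^ q - X : F[X]) ∣ ∏ u ∈ U, (X + C (u.1 * s - u.2)) := by
    have h0 := (FiniteField.X_pow_card_sub_X_ne_zero F hq1)
    have hroots : (X ^ q - X : F[X]).roots = Finset.univ.val :=
      FiniteField.roots_X_pow_card_sub_X F
    have hsplits : (X ^ q - X : F[X]).Splits := by
      rw [splits_iff_card_roots, hroots, FiniteField.X_pow_card_sub_X_natDegree_eq F hq1]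
      simp [hq]
    refine hsplits.dvd_of_roots_le_roots h0 ?_
    rw [hroots, Multiset.le_iff_subset Finset.univ.nodup]
    intro t _
    rw [mem_roots (hmonic _).ne_zero, IsRoot.def, eval_prod]
    obtain ⟨u, hu, hut⟩ := hU s t
    exact Finset.prod_eq_zero hu (by simp [hut]; ring)
  have hcard : q ≤ U.card := by
    have := natDegree_le_of_dvd (hdvd 0) (hmonic _).ne_zero
    rwa [hnat, FiniteField.X_pow_card_sub_X_natDegree_eq F hq1] at this
  refine ⟨hcard, fun j hj hjq => ?_⟩
  have hconst (s : F) : (∏ u ∈ U, (X + C (u.1 * s - u.2))).coeff j =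
      if j = U.card - q + 1 then -1 else 0 := by
    obtain ⟨G, hG⟩ := hdvd s
    have hXm : (X ^ q - X : F[X]).Monic := monic_X_pow_sub (by simpa using hq1)
    have hGm : G.Monic := hXm.of_mul_monic_left (hG ▸ hmonic _)
    have hGdeg : G.natDegree = U.card - q := by
      have := congrArg natDegree hG
      rw [hnat, hXm.natDegree_mul hGm, FiniteField.X_pow_card_sub_X_natDegree_eq F hq1] at this
      omega
    rw [hG, sub_mul, coeff_sub, coeff_X_pow_mul', if_neg (by omega)]
    obtain ⟨i, rfl⟩ : ∃ i, j = i + 1 := ⟨j - 1, by omega⟩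
    rw [coeff_X_mul]
    split_ifs with hi
    · rw [show i = G.natDegree by omega, hGm.coeff_natDegree]
      simp
    · rw [coeff_eq_zero_of_natDegree_lt (by omega)]
      simp
  set c : F := if j = U.card - q + 1 then -1 else 0
  set σ : F[X] := ∑ t ∈ U.powersetCard (U.card - j), ∏ u ∈ t, (C u.1 * X - C u.2) with hσ
  have hlin (u : F × F) : (C u.1 * X - C u.2).natDegree ≤ 1 := by
    compute_degree
  have hσdeg : σ.natDegree ≤ U.card - j := by
    refine natDegree_sum_le_of_forall_le _ _ fun t ht => ?_
    refine (natDegree_prod_le _ _).trans ((Finset.sum_le_sum fun u _ => hlin u).trans ?_)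
    simp [(Finset.mem_powersetCard.1 ht).2]
  have hσc : σ - C c = 0 := by
    refine eq_zero_of_natDegree_lt_card_of_eval_eq_zero (σ - C c) Function.injective_id
      (fun s => ?_) ?_
    · rw [id, eval_sub, eval_C, ← hconst s, Finset.prod_X_add_C_coeff _ _ (by omega), hσ,
        eval_finsetSum]
      simp [eval_prod]
    · rw [natDegree_sub_C]
      omega
  rw [Finset.prod_X_add_C_coeff _ _ (by omega)]
  have htop : σ.coeff (U.card - j) = 0 := by
    rw [sub_eq_zero.1 hσc, coeff_C_of_ne_zero (by omega)]
  rw [hσ, finsetSum_coeff] at htop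
  rw [← htop]
  refine Finset.sum_congr rfl fun t ht => ?_
  have := coeff_prod_of_natDegree_le (s := t) (fun u : F × F => C u.1 * X - C u.2) 1
    fun u _ => hlin u
  rw [(Finset.mem_powersetCard.1 ht).2, mul_one] at this
  rw [this]
  simp [coeff_C]

open Polynomial in
/-- An affine set of fewer than `(3p + 1) / 2` points meeting all non-vertical lines contains a
vertical line. -/
theorem exists_vertical_line_subset {F : Type*} [Field F] [Fintype F] {p : ℕ} (hp : p.Prime)
    (hF : Fintype.card F = p) (U : Finset (F × F))
    (hU : ∀ m c : F, ∃ u ∈ U, u.2 = m * u.1 + c) (hcard : 2 * U.card < 3 * p + 1) :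
    ∃ a : F, ∀ b : F, (a, b) ∈ U := by
  classical
  have : Fact p.Prime := ⟨hp⟩
  have : CharP F p := charP_of_card_eq_prime (hF)
  obtain ⟨hle, hlac⟩ := redei_lacunary U hU
  rw [hF] at hle hlac
  set f : F[X] := ∏ u ∈ U, (X + C u.1) with hf
  have hfm : f.Monic := monic_prod_of_monic _ _ fun u _ => monic_X_add_C _
  have hfdeg : f.natDegree = U.card := by
    rw [hf, natDegree_prod_of_monic _ _ fun u _ => monic_X_add_C _]
    simp
  have hfs : f.Splits := Splits.prod fun u _ => Splits.X_add_C _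
  have hXm : (X ^ p : F[X]).Monic := monic_X_pow p
  set g := f /ₘ X ^ p with hg
  set h := f %ₘ X ^ p with hh
  have hfgh : h + X ^ p * g = f := modByMonic_add_div f (X ^ p)
  have hgdeg : g.natDegree = U.card - p := by
    rw [hg, natDegree_divByMonic f hXm, hfdeg, natDegree_X_pow]
  have hg0 : g ≠ 0 := by
    intro h0
    rw [hg, divByMonic_eq_zero_iff hXm, degree_eq_natDegree hfm.ne_zero, hfdeg, degree_X_pow] at h0
    exact absurd (Nat.cast_lt.1 h0) (not_lt.2 hle)
  have hhdeg : h.natDegree ≤ g.natDegree := by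
    refine natDegree_le_iff_coeff_eq_zero.2 fun j hj => ?_
    by_cases hjp : j < p
    · have := congrArg (fun r => r.coeff j) hfgh
      simp only [coeff_add, coeff_X_pow_mul', if_neg (not_le.2 hjp), add_zero] at this
      rw [this]
      exact hlac j (by omega) hjp
    · refine coeff_eq_zero_of_degree_lt ((degree_modByMonic_lt f hXm).trans_le ?_)
      rw [degree_X_pow]
      exact_mod_cast not_lt.1 hjp
  set c := h.coeff g.natDegree / g.leadingCoeff with hc
  have hlead : g.leadingCoeff ≠ 0 := leadingCoeff_ne_zero.2 hg0
  have hr : h - C c * g = 0 := by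
    have hcoeff : (h - C c * g).coeff g.natDegree = 0 := by
      rw [coeff_sub, coeff_C_mul, hc, coeff_natDegree, div_mul_cancel₀ _ hlead, sub_self]
    have hrdeg : (h - C c * g).natDegree ≤ g.natDegree :=
      (natDegree_sub_le _ _).trans (max_le hhdeg (natDegree_C_mul_le _ _))
    rcases hrdeg.lt_or_eq with hlt | heq
    · exact lacunary_remainder_eq_zero hF (c := c) hfs hg0 (by rw [← hfgh]; ring) hlt (by omega)
    · rwa [← heq, coeff_natDegree, leadingCoeff_eq_zero] at hcoeff
  have hfac : (X + C c) ^ p ∣ f := by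
    refine ⟨g, ?_⟩
    rw [add_pow_char, ← C_pow, show c ^ p = c by rw [← hF, FiniteField.pow_card], ← hfgh]
    linear_combination hr
  have hmult : p ≤ rootMultiplicity (-c) f := by
    rw [le_rootMultiplicity_iff hfm.ne_zero]
    simpa using hfac
  have hcount : rootMultiplicity (-c) f = (U.filter fun u => u.1 = c).card := by
    rw [← count_roots, hf, roots_prod _ _ hfm.ne_zero]
    simp only [roots_X_add_C, Multiset.bind_singleton]
    rw [Multiset.count_map, Finset.card_def, Finset.filter_val]
    simp [eq_comm]
  refine ⟨c, ?_⟩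
  have hsub : (U.filter fun u => u.1 = c) ⊆ Finset.univ.image (fun b : F => (c, b)) := by
    rintro ⟨a, b⟩ hu
    simp only [Finset.mem_filter] at hu
    simp [hu.2]
  have hinj : Function.Injective (fun b : F => (c, b)) := fun b b' hb => (Prod.mk.inj hb).2
  have heq := Finset.eq_of_subset_of_card_le hsub (by
    rw [Finset.card_image_of_injective _ hinj, Finset.card_univ, hF, ← hcount]
    exact hmult)
  intro b
  have : (c, b) ∈ U.filter fun u => u.1 = c := heq ▸ Finset.mem_image_of_mem _ (Finset.mem_univ b)
  exact (Finset.mem_filter.1 this).1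

theorem finrank_span_pair_eq_two {F V : Type*} [Field F] [AddCommGroup V] [Module F V] {u v : V}
    (h : ∀ x y : F, x • u + y • v = 0 → x = 0 ∧ y = 0) :
    finrank F (Submodule.span F {u, v}) = 2 := by
  rw [← Matrix.range_cons_cons_empty u v ![],
    finrank_span_eq_card (LinearIndependent.pair_iff.2 h), Fintype.card_fin]

/-- A blocking set without lines that has a tangent line has at least `3 (p + 1) / 2` points. -/
theorem card_blocking_set_of_tangent {p : ℕ} (hp : p.Prime)
    {F V : Type*} [Field F] [Fintype F] (hF : Fintype.card F = p)
    [AddCommGroup V] [Module F V] [Finite V] (hV : finrank F V = 3)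
    (B : Set (Submodule F V))
    (hBpts : ∀ P ∈ B, finrank F P = 1)
    (hblock : ∀ L : Submodule F V, finrank F L = 2 → ∃ P ∈ B, P ≤ L)
    (hnoline : ∀ L : Submodule F V, finrank F L = 2 →
      ∃ P : Submodule F V, finrank F P = 1 ∧ P ≤ L ∧ P ∉ B)
    {L P : Submodule F V} (hL : finrank F L = 2) (hP : P ∈ B) (hPL : P ≤ L)
    (htangent : ∀ Q ∈ B, Q ≤ L → Q = P) :
    3 * (p + 1) ≤ 2 * B.ncard := by
  classical
  by_contra! hlt
  have span_of_finrank {Q : Submodule F V} (hQ : finrank F Q = 1) :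
      ∃ v ∈ Q, v ≠ 0 ∧ Q = Submodule.span F {v} := by
    obtain ⟨v, hv, h⟩ := finrank_eq_one_iff'.1 hQ
    refine ⟨v, v.2, by simpa using hv, le_antisymm (fun w hw => ?_) ?_⟩
    · obtain ⟨c, hc⟩ := h ⟨w, hw⟩
      exact Submodule.mem_span_singleton.2 ⟨c, congrArg Subtype.val hc⟩
    · simp
  obtain ⟨e₁, he₁P, he₁, hPe₁⟩ := span_of_finrank (hBpts P hP)
  obtain ⟨e₀, he₀L, he₀P⟩ : ∃ e₀ ∈ L, e₀ ∉ P := by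
    by_contra! h
    have := Submodule.finrank_mono (show L ≤ P from h)
    rw [hL, hBpts P hP] at this
    omega
  obtain ⟨e₂, he₂⟩ : ∃ e₂, e₂ ∉ L := by
    by_contra! h
    rw [(Submodule.eq_top_iff' (p := L)).2 h, finrank_top, hV] at hL
    omega
  have he₁L := hPL he₁P
  have hind (x y z : F) (h : x • e₀ + y • e₁ + z • e₂ = 0) : x = 0 ∧ y = 0 ∧ z = 0 := by
    have hz : z = 0 := by
      by_contra hz
      refine he₂ ((Submodule.smul_mem_iff L hz).1 ?_)
      rw [← neg_eq_of_add_eq_zero_right h]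
      exact L.neg_mem (L.add_mem (L.smul_mem _ he₀L) (L.smul_mem _ he₁L))
    subst hz
    rw [zero_smul, add_zero] at h
    have hx : x = 0 := by
      by_contra hx
      refine he₀P ((Submodule.smul_mem_iff P hx).1 ?_)
      rw [← neg_eq_of_add_eq_zero_left h]
      exact P.neg_mem (P.smul_mem _ he₁P)
    subst hx
    rw [zero_smul, zero_add] at h
    exact ⟨rfl, (smul_eq_zero.1 h).resolve_right he₁, rfl⟩
  set pt : F × F → Submodule F V := fun u => Submodule.span F {u.1 • e₀ + u.2 • e₁ + e₂} with hpt
  have hptinj : Function.Injective pt := by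
    intro u u' h
    have hmem : u.1 • e₀ + u.2 • e₁ + e₂ ∈ pt u' := h ▸ Submodule.mem_span_singleton_self _
    obtain ⟨c, hc⟩ := Submodule.mem_span_singleton.1 hmem
    obtain ⟨h0, h1, h2⟩ := hind (c * u'.1 - u.1) (c * u'.2 - u.2) (c - 1) (by
      rw [← sub_eq_zero] at hc
      rw [← hc]
      module)
    rw [sub_eq_zero.1 h2] at h0 h1
    exact Prod.ext (by linear_combination -h0) (by linear_combination -h1)
  have hptP (u : F × F) : pt u ≠ P := by
    intro h
    refine he₂ ?_
    have hmem : u.1 • e₀ + u.2 • e₁ + e₂ ∈ L :=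
      hPL (h ▸ Submodule.mem_span_singleton_self _)
    exact (Submodule.add_mem_iff_right L
      (L.add_mem (L.smul_mem _ he₀L) (L.smul_mem _ he₁L))).1 hmem
  set U : Finset (F × F) := Finset.univ.filter fun u => pt u ∈ B with hUdef
  have hBfin : B.Finite := Set.toFinite B
  have hUcard : U.card + 1 ≤ B.ncard := by
    have h1 : insert P (U.image pt) ⊆ hBfin.toFinset := by
      intro Q hQ
      rw [Set.Finite.mem_toFinset]
      rcases Finset.mem_insert.1 hQ with rfl | hQ
      · exact hP
      · obtain ⟨u, hu, rfl⟩ := Finset.mem_image.1 hQ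
        exact (Finset.mem_filter.1 hu).2
    have h2 := Finset.card_le_card h1
    rwa [Finset.card_insert_of_notMem (by simp [hptP]), Finset.card_image_of_injective _ hptinj,
      ← Set.ncard_eq_toFinset_card B hBfin] at h2
  have hUblock (m c : F) : ∃ u ∈ U, u.2 = m * u.1 + c := by
    obtain ⟨Q, hQB, hQ⟩ := hblock (Submodule.span F {e₀ + m • e₁, e₂ + c • e₁})
      (finrank_span_pair_eq_two fun x y h => by
        obtain ⟨hx, -, hy⟩ := hind x (x * m + y * c) y (by rw [← h]; module)
        exact ⟨hx, hy⟩)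
    obtain ⟨v, hvQ, hv, rfl⟩ := span_of_finrank (hBpts Q hQB)
    obtain ⟨x, y, rfl⟩ := Submodule.mem_span_pair.1 (hQ hvQ)
    by_cases hy : y = 0
    · subst hy
      simp only [zero_smul, add_zero] at *
      have hx : x ≠ 0 := by
        rintro rfl
        simp at hv
      have hQP := htangent _ hQB (by
        rw [Submodule.span_singleton_le_iff_mem]
        exact L.smul_mem _ (L.add_mem he₀L (L.smul_mem _ he₁L)))
      rw [hQP, Submodule.smul_mem_iff P hx,
        Submodule.add_mem_iff_left P (P.smul_mem _ he₁P)] at hvQ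
      exact absurd hvQ he₀P
    · refine ⟨(x / y, m * (x / y) + c), ?_, rfl⟩
      simp only [hUdef, Finset.mem_filter, Finset.mem_univ, true_and, hpt]
      rw [← Submodule.span_singleton_smul_eq (IsUnit.mk0 y hy)]
      convert hQB using 3
      match_scalars <;> field_simp
  obtain ⟨a, ha⟩ := exists_vertical_line_subset hp hF U hUblock (by omega)
  obtain ⟨Q, hQ1, hQ, hQB⟩ := hnoline (Submodule.span F {e₁, e₂ + a • e₀})
    (finrank_span_pair_eq_two fun x y h => by
      obtain ⟨-, hx, hy⟩ := hind (y * a) x y (by rw [← h]; module)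
      exact ⟨hx, hy⟩)
  obtain ⟨v, hvQ, hv, rfl⟩ := span_of_finrank hQ1
  obtain ⟨x, y, rfl⟩ := Submodule.mem_span_pair.1 (hQ hvQ)
  refine hQB ?_
  by_cases hy : y = 0
  · subst hy
    simp only [zero_smul, add_zero] at *
    have hx : x ≠ 0 := by
      rintro rfl
      simp at hv
    rwa [Submodule.span_singleton_smul_eq (IsUnit.mk0 x hx), ← hPe₁]
  · have hmem := (Finset.mem_filter.1 (ha (x / y))).2
    simp only [hpt] at hmem
    rw [← Submodule.span_singleton_smul_eq (IsUnit.mk0 y hy)] at hmem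
    convert hmem using 3
    match_scalars <;> field_simp

/-- Blokhuis, 1994: a blocking set of `PG(2,p)`, `p` prime, not containing a line,
has at least `3(p+1)/2` points. -/
theorem blocking_set_prime_plane (p : ℕ) (hp : p.Prime)
    (F : Type) [Field F] [Fintype F] (hF : Fintype.card F = p)
    (B : Set (Submodule F (Fin 3 → F)))
    (hBpts : ∀ P ∈ B, finrank F P = 1)
    (hblock : ∀ L : Submodule F (Fin 3 → F), finrank F L = 2 → ∃ P ∈ B, P ≤ L)
    (hnoline : ∀ L : Submodule F (Fin 3 → F), finrank F L = 2 →
      ∃ P : Submodule F (Fin 3 → F), finrank F P = 1 ∧ P ≤ L ∧ P ∉ B) :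
    2 * B.ncard ≥ 3 * (p + 1) := by
  obtain ⟨M, hMB, hM⟩ := exists_minimal_le_of_wellFoundedLT
    (fun M : Set (Submodule F (Fin 3 → F)) =>
      ∀ L : Submodule F (Fin 3 → F), finrank F L = 2 → ∃ P ∈ M, P ≤ L) B hblock
  have hMblock := hM.prop
  obtain ⟨L₀, hL₀⟩ : ∃ L : Submodule F (Fin 3 → F), finrank F L = 2 :=
    ⟨_, finrank_span_pair_eq_two (u := Pi.single 0 1) (v := Pi.single 1 1) fun x y h =>
      ⟨by simpa [Pi.single_apply] using congrFun h 0, by simpa [Pi.single_apply] using congrFun h 1⟩⟩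
  obtain ⟨P, hPM, -⟩ := hMblock L₀ hL₀
  have hnot : ¬ ∀ L : Submodule F (Fin 3 → F), finrank F L = 2 → ∃ Q ∈ M \ {P}, Q ≤ L :=
    fun h => (hM.le_of_le h Set.sdiff_subset hPM).2 rfl
  push Not at hnot
  obtain ⟨L, hL, hLM⟩ := hnot
  have htangent : ∀ Q ∈ M, Q ≤ L → Q = P := fun Q hQ hQL => by
    by_contra hne
    exact hLM Q ⟨hQ, hne⟩ hQL
  obtain ⟨Q, hQM, hQL⟩ := hMblock L hL
  have hPL : P ≤ L := htangent Q hQM hQL ▸ hQL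
  have := card_blocking_set_of_tangent hp hF (by simp) M (fun P hP => hBpts P (hMB hP)) hMblock
    (fun L hL => by
      obtain ⟨R, hR1, hRL, hRB⟩ := hnoline L hL
      exact ⟨R, hR1, hRL, fun hRM => hRB (hMB hRM)⟩) hL hPM hPL htangent
  have hle : M.ncard ≤ B.ncard := Set.ncard_le_ncard hMB (Set.toFinite B)
  omega
end

section
/- Let q = p^h with p prime and let B be a minimal blocking set in PG(2,q) with 2·|B| < 3(q+1). Then for every line l of PG(2,q), |B ∩ l| ≡ 1 (mod p). -/
open Module

section Polynomial

open Polynomial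

/-- A bivariate polynomial has total degree at most `n`. -/
def Polynomial.TotalDegreeLE {R : Type*} [CommRing R] (P : R[X][X]) (n : ℕ) : Prop :=
  ∀ i j, (P.coeff i).coeff j ≠ 0 → i + j ≤ n

namespace Polynomial.TotalDegreeLE

variable {R : Type*} [CommRing R] {P Q : R[X][X]} {m n : ℕ}

lemma sub (hP : TotalDegreeLE P n) (hQ : TotalDegreeLE Q n) : TotalDegreeLE (P - Q) n := by
  intro i j hij
  by_cases h : (P.coeff i).coeff j = 0
  · exact hQ i j fun h' => hij (by simp [h, h'])
  · exact hP i j h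

lemma add (hP : TotalDegreeLE P n) (hQ : TotalDegreeLE Q n) : TotalDegreeLE (P + Q) n := by
  intro i j hij
  by_cases h : (P.coeff i).coeff j = 0
  · exact hQ i j fun h' => hij (by simp [h, h'])
  · exact hP i j h

lemma mul (hP : TotalDegreeLE P m) (hQ : TotalDegreeLE Q n) :
    TotalDegreeLE (P * Q) (m + n) := by
  intro i j hij
  rw [coeff_mul, finsetSum_coeff] at hij
  obtain ⟨a, ha, hij⟩ := Finset.exists_ne_zero_of_sum_ne_zero hij
  rw [coeff_mul] at hij
  obtain ⟨b, hb, hij⟩ := Finset.exists_ne_zero_of_sum_ne_zero hij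
  have h₁ := hP _ _ (left_ne_zero_of_mul hij)
  have h₂ := hQ _ _ (right_ne_zero_of_mul hij)
  rw [Finset.HasAntidiagonal.mem_antidiagonal] at ha hb
  omega

lemma one : TotalDegreeLE (1 : R[X][X]) 0 := by
  intro i j hij
  rcases i with _ | i
  · rcases j with _ | j
    · rfl
    · simp [coeff_one] at hij
  · simp [coeff_one] at hij

lemma prod {ι : Type*} {s : Finset ι} {f : ι → R[X][X]} (hf : ∀ i ∈ s, TotalDegreeLE (f i) 1) :
    TotalDegreeLE (∏ i ∈ s, f i) s.card := by
  classical
  induction s using Finset.induction_on with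
  | empty => simpa using one
  | insert a s ha ih =>
    rw [Finset.prod_insert ha, Finset.card_insert_of_notMem ha, add_comm]
    exact (hf a (by simp)).mul (ih fun i hi => hf i (by simp [hi]))

lemma X_pow : TotalDegreeLE (X ^ n : R[X][X]) n := by
  intro i j hij
  rw [coeff_X_pow] at hij
  split_ifs at hij with h
  · rcases j with _ | j
    · omega
    · simp [coeff_one] at hij
  · simp at hij

lemma C_of_natDegree_le {p : R[X]} (hp : p.natDegree ≤ n) : TotalDegreeLE (C p) n := by
  intro i j hij
  rw [coeff_C] at hij
  split_ifs at hij with h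
  · have := le_natDegree_of_ne_zero hij
    omega
  · simp at hij

lemma mono (hP : TotalDegreeLE P m) (h : m ≤ n) : TotalDegreeLE P n :=
  fun i j hij => (hP i j hij).trans h

lemma derivative (hP : TotalDegreeLE P n) : TotalDegreeLE (derivative P) (n - 1) := by
  intro i j hij
  have h : ((i : R[X]) + 1) = C ((i : R) + 1) := by simp
  rw [coeff_derivative, h, coeff_mul_C] at hij
  have := hP _ _ (left_ne_zero_of_mul hij)
  omega

/-- Division with remainder by a monic polynomial whose total degree equals its degree in the
outer variable respects total degrees. -/
lemma exists_eq_mul_add [Nontrivial R] {D : R[X][X]} (hD : D.Monic)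
    (hDd : TotalDegreeLE D D.natDegree) (hP : TotalDegreeLE P n) :
    ∃ Q S : R[X][X], P = D * Q + S ∧ S.degree < D.degree ∧
      TotalDegreeLE Q (n - D.natDegree) ∧ TotalDegreeLE S n := by
  induction hd : P.degree using WellFoundedLT.induction generalizing P with
  | ind d ih =>
    subst hd
    by_cases h : D.degree ≤ P.degree ∧ P ≠ 0
    · have hdeg := natDegree_le_natDegree h.1
      have hlead : TotalDegreeLE (C P.leadingCoeff * X ^ (P.natDegree - D.natDegree))
          (n - D.natDegree) := by
        intro i j hij
        rw [coeff_C_mul, coeff_X_pow] at hij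
        split_ifs at hij with hi
        · rw [mul_one] at hij
          have := hP _ _ hij
          omega
        · simp at hij
      have hn : P.natDegree ≤ n := by
        have := hP P.natDegree P.leadingCoeff.natDegree
          (leadingCoeff_ne_zero.2 (leadingCoeff_ne_zero.2 h.2))
        omega
      obtain ⟨Q, S, hQS, hS, hQ, hSn⟩ := ih _ (div_wf_lemma h hD)
        (hP.sub ((hDd.mul hlead).mono (by omega))) rfl
      exact ⟨Q + C P.leadingCoeff * X ^ (P.natDegree - D.natDegree), S,
        by linear_combination hQS, hS, hQ.add hlead, hSn⟩
    · refine ⟨0, P, by simp, ?_, fun i j hij => by simp at hij, hP⟩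
      by_cases h0 : P = 0
      · rw [h0, degree_zero]
        exact bot_lt_iff_ne_bot.2 (degree_ne_bot.2 hD.ne_zero)
      · exact lt_of_not_ge fun h' => h ⟨h', h0⟩

end Polynomial.TotalDegreeLE

section FiniteField

variable {F : Type*} [Field F] [Fintype F]

lemma FiniteField.X_pow_card_sub_X_dvd {p : F[X]} (hp : ∀ x, p.eval x = 0) :
    (X ^ Fintype.card F - X : F[X]) ∣ p := by
  rcases eq_or_ne p 0 with rfl | h0
  · simp
  have hne := FiniteField.X_pow_card_sub_X_ne_zero F (Fintype.one_lt_card (α := F))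
  have hroots := FiniteField.roots_X_pow_card_sub_X F
  refine Splits.dvd_of_roots_le_roots (splits_iff_card_roots.2 ?_) hne ?_
  · rw [hroots, FiniteField.X_pow_card_sub_X_natDegree_eq F Fintype.one_lt_card]
    rfl
  · rw [hroots, Multiset.le_iff_subset Finset.univ.nodup]
    intro x _
    exact (mem_roots h0).2 (hp x)

lemma FiniteField.rootMultiplicity_X_pow_card_sub_X (x : F) :
    (X ^ Fintype.card F - X : F[X]).rootMultiplicity x = 1 := by
  classical
  rw [← count_roots, FiniteField.roots_X_pow_card_sub_X]
  exact Multiset.count_eq_one_of_mem Finset.univ.nodup (Finset.mem_univ x)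

/-- A remainder vanishing under all specializations of the inner variable is a multiple of
`Y ^ q - Y`. -/
lemma FiniteField.exists_eq_C_mul_of_forall_map_dvd {D S : F[X][X]} (hD : D.Monic)
    (hS : S.degree < D.degree)
    (hdvd : ∀ y, D.map (evalRingHom y) ∣ S.map (evalRingHom y)) :
    ∃ g : F[X][X], S = C (X ^ Fintype.card F - X) * g ∧
      ∀ n, S.TotalDegreeLE n →
        ∀ i j, (g.coeff i).coeff j ≠ 0 → i + j + Fintype.card F ≤ n := by
  have hzero : ∀ y, S.map (evalRingHom y) = 0 := fun y => by
    refine eq_zero_of_dvd_of_degree_lt (hdvd y) ?_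
    rw [hD.degree_map]
    exact degree_map_le.trans_lt hS
  have hC : C (X ^ Fintype.card F - X : F[X]) ∣ S := by
    refine (C_dvd_iff_dvd_coeff _ _).2 fun i => FiniteField.X_pow_card_sub_X_dvd fun y => ?_
    have := congrArg (fun p => p.coeff i) (hzero y)
    simpa using this
  obtain ⟨g, rfl⟩ := hC
  refine ⟨g, rfl, fun n hn i j hij => ?_⟩
  have hg : g.coeff i ≠ 0 := fun h => hij (by simp [h])
  have hne := FiniteField.X_pow_card_sub_X_ne_zero F (Fintype.one_lt_card (α := F))
  have hcoeff := hn i ((X ^ Fintype.card F - X : F[X]) * g.coeff i).natDegree (by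
    rw [coeff_C_mul]
    exact leadingCoeff_ne_zero.2 (mul_ne_zero hne hg))
  rw [natDegree_mul hne hg,
    FiniteField.X_pow_card_sub_X_natDegree_eq F Fintype.one_lt_card] at hcoeff
  have := le_natDegree_of_ne_zero hij
  omega

end FiniteField

section Splits

variable {F : Type*} [Field F]

/-- If every root of a split polynomial `p` is a root of `g`, then `p` divides `g` times its
derivative. -/
lemma Polynomial.Splits.dvd_mul_derivative {p g : F[X]} (hp : p.Splits) (hp0 : p ≠ 0)
    (hroot : ∀ x, p.eval x = 0 → g.eval x = 0) : p ∣ g * derivative p := by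
  classical
  rcases eq_or_ne (g * derivative p) 0 with h0 | h0
  · simp [h0]
  refine hp.dvd_of_roots_le_roots hp0 (Multiset.le_iff_count.2 fun x => ?_)
  rw [count_roots, count_roots]
  rcases Nat.eq_zero_or_pos (p.rootMultiplicity x) with hm | hm
  · simp [hm]
  rw [le_rootMultiplicity_iff h0]
  have hx : X - C x ∣ g := dvd_iff_isRoot.2 (hroot x ((rootMultiplicity_pos hp0).1 hm))
  have hd := mul_dvd_mul hx
    (pow_sub_one_dvd_derivative_of_pow_dvd (pow_rootMultiplicity_dvd p x))
  rwa [← pow_succ', Nat.sub_add_cancel hm] at hd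

lemma Polynomial.dvd_rootMultiplicity_of_derivative_eq_zero {p : ℕ} [Fact p.Prime] [CharP F p]
    {f : F[X]} (hf : derivative f = 0) (x : F) : p ∣ f.rootMultiplicity x := by
  have := ExpChar.prime (R := F) (Fact.out : p.Prime)
  rw [← expand_contract p hf (Fact.out : p.Prime).ne_zero, rootMultiplicity_expand]
  exact dvd_mul_right _ _

lemma Polynomial.rootMultiplicity_prod_X_sub_C {ι : Type*} [DecidableEq F] (s : Finset ι)
    (r : ι → F) (x : F) :
    (∏ i ∈ s, (X - C (r i))).rootMultiplicity x = (s.filter fun i => r i = x).card := by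
  classical
  have : (∏ i ∈ s, (X - C (r i))) = ((s.val.map r).map fun a => X - C a).prod := by
    rw [Multiset.map_map]; rfl
  rw [← count_roots, this, roots_multiset_prod_X_sub_C, Multiset.count_map, Finset.card_def,
    Finset.filter_val]
  simp only [eq_comm]

end Splits

/-- The affine form of the theorem: `S` is a set of points `(a, b)` of the affine plane, and the
lines are those of equation `b = x + a * y`. -/
theorem affine_card_filter_modEq_one {p : ℕ} [Fact p.Prime] {F : Type*} [Field F] [Fintype F]
    [DecidableEq F] [CharP F p] (S : Finset (F × F))
    (hblock : ∀ x y, ∃ s ∈ S, s.2 = x + s.1 * y)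
    (htangent : ∀ s ∈ S, ∃ x y, s.2 = x + s.1 * y ∧ ∀ t ∈ S, t.2 = x + t.1 * y → t = s)
    (hcard : 2 * S.card < 3 * Fintype.card F + 1) (x y : F) :
    (S.filter fun s => s.2 = x + s.1 * y).card ≡ 1 [MOD p] := by
  set q := Fintype.card F with hq
  have hq1 : 1 < q := Fintype.one_lt_card
  have hCq : ∀ c : F, (C c : F[X]) ^ q = C c := fun c => by rw [← C_pow, FiniteField.pow_card]
  let ℓ : F × F → F[X][X] := fun s => X - C (C s.2 - C s.1 * X)
  let R : F[X][X] := ∏ s ∈ S, ℓ s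
  have hRmonic : R.Monic := monic_prod_of_monic _ _ fun s _ => monic_X_sub_C _
  have hRdeg : R.natDegree = S.card := by
    rw [natDegree_prod_of_monic _ _ fun s _ => monic_X_sub_C _]
    simp only [ℓ, natDegree_X_sub_C, Finset.sum_const, smul_eq_mul, mul_one]
  have hRT : R.TotalDegreeLE S.card := by
    refine TotalDegreeLE.prod fun s _ => TotalDegreeLE.sub ?_ ?_
    · simpa using TotalDegreeLE.X_pow (R := F) (n := 1)
    · exact TotalDegreeLE.C_of_natDegree_le (by compute_degree)
  have hRmap : ∀ y, R.map (evalRingHom y) = ∏ s ∈ S, (X - C (s.2 - s.1 * y)) := fun y => by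
    simp [R, ℓ, Polynomial.map_prod]
  have hRmult : ∀ x y, (R.map (evalRingHom y)).rootMultiplicity x =
      (S.filter fun s => s.2 = x + s.1 * y).card := fun x y => by
    simp only [hRmap, rootMultiplicity_prod_X_sub_C, sub_eq_iff_eq_add]
  have hReval : ∀ x, R.eval (C x) = ∏ s ∈ S, (C x - (C s.2 - C s.1 * X)) := fun x => by
    simp [R, ℓ, eval_prod]
  have hRmap0 : ∀ y, R.map (evalRingHom y) ≠ 0 := fun y => (hRmonic.map _).ne_zero
  -- Decompose `R` along the two field equations.
  let D : F[X][X] := X ^ q - X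
  have hDmonic : D.Monic := monic_X_pow_sub (by simpa using hq1)
  have hDdeg : D.natDegree = q := by
    rw [show D = X ^ q - X from rfl, natDegree_sub_eq_left_of_natDegree_lt] <;> simp [hq1]
  have hDmap : ∀ y, D.map (evalRingHom y) = X ^ q - X := fun y => by simp [D]
  have hDT : D.TotalDegreeLE D.natDegree := by
    rw [hDdeg]
    refine TotalDegreeLE.X_pow.sub (TotalDegreeLE.mono (m := 1) ?_ hq1.le)
    simpa using TotalDegreeLE.X_pow (R := F) (n := 1)
  have hDR : ∀ y, D.map (evalRingHom y) ∣ R.map (evalRingHom y) := fun y => by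
    rw [hDmap]
    refine FiniteField.X_pow_card_sub_X_dvd fun x => ?_
    obtain ⟨s, hs, hxy⟩ := hblock x y
    rw [hRmap, eval_prod]
    exact Finset.prod_eq_zero hs (by simp [hxy])
  obtain ⟨f, r, hR, hrdeg, hfT, hrT⟩ := TotalDegreeLE.exists_eq_mul_add hDmonic hDT hRT
  obtain ⟨g, hrg, hgT⟩ := FiniteField.exists_eq_C_mul_of_forall_map_dvd hDmonic hrdeg fun y => by
    have h := hDR y
    rw [hR, Polynomial.map_add, Polynomial.map_mul] at h
    exact (dvd_add_right (dvd_mul_right _ _)).1 h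
  replace hgT := hgT _ hrT
  rw [hDdeg] at hfT
  have hRf : ∀ y, R.map (evalRingHom y) = (X ^ q - X) * f.map (evalRingHom y) := fun y => by
    rw [hR, hrg]
    simp [hDmap, ← hq, hCq]
  have hqS : q ≤ S.card := by
    have h := natDegree_le_of_dvd (hDR 0) (hRmap0 0)
    rwa [hDmonic.natDegree_map, hRmonic.natDegree_map, hDdeg, hRdeg] at h
  have hDf : D * f = R - r := by rw [hR]; ring
  have hrR : r.degree < R.degree := hrdeg.trans_le (by
    rw [degree_eq_natDegree hDmonic.ne_zero, degree_eq_natDegree hRmonic.ne_zero, hDdeg, hRdeg]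
    exact_mod_cast hqS)
  have hfmonic : f.Monic := hDmonic.of_mul_monic_left (hDf ▸ hRmonic.sub_of_left hrR)
  have hfdeg : f.natDegree = S.card - q := by
    have h := congrArg natDegree hDf
    rw [hDmonic.natDegree_mul hfmonic,
      natDegree_eq_of_degree_eq (degree_sub_eq_left_of_degree_lt hrR), hRdeg, hDdeg] at h
    omega
  have hfmap0 : ∀ y, f.map (evalRingHom y) ≠ 0 := fun y => (hfmonic.map _).ne_zero
  -- The multiplicity of a root of `f(·, y)`.
  have hmult : ∀ x y, (S.filter fun s => s.2 = x + s.1 * y).card =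
      1 + (f.map (evalRingHom y)).rootMultiplicity x := fun x y => by
    rw [← hRmult, hRf, rootMultiplicity_mul (hRf y ▸ hRmap0 y),
      FiniteField.rootMultiplicity_X_pow_card_sub_X]
  have htwo : ∀ x y, (f.map (evalRingHom y)).eval x = 0 →
      1 < (S.filter fun s => s.2 = x + s.1 * y).card := fun x y h => by
    have := (rootMultiplicity_pos (hfmap0 y)).2 h
    rw [hmult]
    omega
  have hgroot : ∀ x y, (f.map (evalRingHom y)).eval x = 0 →
      (g.map (evalRingHom y)).eval x = 0 := fun x y h => by
    obtain ⟨s, hs, t, ht, hst⟩ := Finset.one_lt_card.1 (htwo x y h)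
    rw [Finset.mem_filter] at hs ht
    have hlin : ∀ s : F × F, s.2 = x + s.1 * y →
        X - C y ∣ (C x - (C s.2 - C s.1 * X) : F[X]) := fun s hs =>
      dvd_iff_isRoot.2 (by simp [hs])
    have hsq : (X - C y) ^ 2 ∣ R.eval (C x) := by
      rw [hReval, ← Finset.mul_prod_erase _ _ hs.1,
        ← Finset.mul_prod_erase _ _ (Finset.mem_erase.2 ⟨hst.symm, ht.1⟩), ← mul_assoc, sq]
      exact (mul_dvd_mul (hlin s hs.2) (hlin t ht.2)).mul_right _
    obtain ⟨v, hv⟩ := hsq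
    have hRg : R.eval (C x) = (X ^ q - X) * g.eval (C x) := by
      rw [hR, hrg]
      simp [D, ← hq, hCq]
    have hder := congrArg (fun u => (derivative u).eval y) (hv.symm.trans hRg)
    have hcast : (q : F) = 0 := FiniteField.cast_card_eq_zero F
    have hyq : y ^ q - y = 0 := sub_eq_zero.2 (FiniteField.pow_card y)
    simp only [derivative_mul, derivative_pow, derivative_sub, derivative_X, derivative_C, eval_add,
      eval_mul, eval_sub, eval_pow, eval_X, eval_C, eval_natCast, map_natCast, hcast, hyq,
      eval_one, sub_self] at hder
    rw [map_evalRingHom_eval, evalEval]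
    simpa using hder
  have hcop : IsRelPrime f g := by
    refine WfDvdMonoid.isRelPrime_of_no_irreducible_factors (fun h => hfmonic.ne_zero h.1)
      fun d hd hdf hdg => ?_
    have hdR : d ∣ R := by
      rw [hR, hrg]
      exact dvd_add (hdf.mul_left _) (hdg.mul_left _)
    obtain ⟨s, hs, hds⟩ := hd.prime.exists_mem_finset_dvd hdR
    have hℓf : ℓ s ∣ f := (hd.associated_of_dvd (irreducible_X_sub_C _) hds).symm.dvd.trans hdf
    obtain ⟨x, y, hxy, htan⟩ := htangent s hs
    have hfx : (f.map (evalRingHom y)).eval x = 0 := by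
      refine eval_eq_zero_of_dvd_of_eval_eq_zero (Polynomial.map_dvd (evalRingHom y) hℓf) ?_
      simp [ℓ, hxy]
    refine (htwo x y hfx).not_ge (Finset.card_le_one.2 fun a ha b hb => ?_)
    rw [Finset.mem_filter] at ha hb
    rw [htan a ha.1 ha.2, htan b hb.1 hb.2]
  have hfdvd : f ∣ g * derivative f := by
    have hGT : (g * derivative f).TotalDegreeLE (S.card - q + (S.card - q - 1)) :=
      TotalDegreeLE.mul (fun i j hij => by have := hgT i j hij; omega) hfT.derivative
    obtain ⟨Q, T, hQT, hTdeg, -, hTT⟩ :=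
      TotalDegreeLE.exists_eq_mul_add hfmonic (by rwa [hfdeg]) hGT
    obtain ⟨u, hu, hudeg⟩ := FiniteField.exists_eq_C_mul_of_forall_map_dvd hfmonic hTdeg fun y => by
      have hsplit : (f.map (evalRingHom y)).Splits := by
        refine Splits.of_dvd (g := R.map (evalRingHom y)) ?_ (hRmap0 y)
          (by rw [hRf]; exact dvd_mul_left _ _)
        rw [hRmap]
        exact Splits.prod fun s _ => Splits.X_sub_C _
      have h := hsplit.dvd_mul_derivative (hfmap0 y) (hgroot · y)
      rw [derivative_map, ← Polynomial.map_mul, hQT, Polynomial.map_add, Polynomial.map_mul] at h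
      exact (dvd_add_right (dvd_mul_right _ _)).1 h
    have hu0 : u = 0 := by
      ext i j
      by_contra hij
      have := hudeg _ hTT i j hij
      omega
    rw [hQT, hu, hu0, mul_zero, add_zero]
    exact dvd_mul_right _ _
  have hf' : derivative f = 0 := by
    by_contra h0
    refine (degree_derivative_lt hfmonic.ne_zero).not_ge
      (degree_le_of_dvd (hcop.dvd_of_dvd_mul_left hfdvd) h0)
  have hdvd : p ∣ (f.map (evalRingHom y)).rootMultiplicity x :=
    dvd_rootMultiplicity_of_derivative_eq_zero (by rw [derivative_map, hf', Polynomial.map_zero]) x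
  rw [hmult]
  simpa using (Nat.ModEq.refl 1).add ((Nat.modEq_zero_iff_dvd).2 hdvd)

end Polynomial

section Geometry

variable {F V : Type*} [Field F] [AddCommGroup V] [Module F V]

lemma Submodule.eq_of_le_of_finrank_eq_one {P Q : Submodule F V} (hP : finrank F P = 1)
    (hQ : finrank F Q = 1) (h : P ≤ Q) : P = Q := by
  have : FiniteDimensional F Q := finite_of_finrank_eq_succ hQ
  exact Submodule.eq_of_le_of_finrank_eq h (hP.trans hQ.symm)

lemma Submodule.exists_eq_span_singleton_of_finrank_eq_one {P : Submodule F V}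
    (hP : finrank F P = 1) : ∃ v, v ≠ 0 ∧ P = Submodule.span F {v} := by
  obtain ⟨v, hv, hv0⟩ := P.exists_mem_ne_zero_of_ne_bot (by rintro rfl; simp at hP)
  refine ⟨v, hv0, (Submodule.eq_of_le_of_finrank_eq_one (finrank_span_singleton hv0) hP ?_).symm⟩
  rwa [Submodule.span_singleton_le_iff_mem]

/-- A point on a line of a projective plane extends to a basis adapted to this flag. -/
lemma exists_basis_of_flag [FiniteDimensional F V] (hV : finrank F V = 3) {P L : Submodule F V}
    (hP : finrank F P = 1) (hL : finrank F L = 2) (hPL : P ≤ L) :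
    ∃ b : Basis (Fin 3) F V, P = Submodule.span F {b 0} ∧ ∀ v, v ∈ L ↔ b.repr v 2 = 0 := by
  obtain ⟨e₀, he₀, rfl⟩ := Submodule.exists_eq_span_singleton_of_finrank_eq_one hP
  obtain ⟨e₁, he₁L, he₁⟩ : ∃ e₁ ∈ L, e₁ ∉ Submodule.span F {e₀} := by
    by_contra! h
    have := Submodule.finrank_mono h
    omega
  obtain ⟨e₂, he₂⟩ : ∃ e₂, e₂ ∉ L := by
    by_contra! h
    rw [(Submodule.eq_top_iff').2 h, finrank_top] at hL
    omega
  have he₀L : e₀ ∈ L := (Submodule.span_singleton_le_iff_mem _ _).1 hPL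
  have hli : LinearIndependent F ![e₂, e₁, e₀] := by
    refine linearIndependent_finCons.2 ⟨linearIndependent_finCons.2
      ⟨LinearIndependent.of_subsingleton 0 he₀, by simpa using he₁⟩, fun h => he₂ ?_⟩
    refine (Submodule.span_le.2 ?_) h
    rintro _ ⟨i, rfl⟩
    fin_cases i
    · exact he₁L
    · exact he₀L
  let b := (basisOfLinearIndependentOfCardEqFinrank hli (by simp [hV])).reindex Fin.revPerm
  have hb0 : b 0 = e₀ := by simp [b, Fin.rev]
  have hb1 : b 1 = e₁ := by simp [b, Fin.rev]
  have hb2 : b 2 = e₂ := by simp [b, Fin.rev]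
  refine ⟨b, by rw [hb0], fun v => ?_⟩
  have hsum := b.sum_repr v
  rw [Fin.sum_univ_three, hb0, hb1, hb2] at hsum
  have hmem : b.repr v 0 • e₀ + b.repr v 1 • e₁ ∈ L :=
    L.add_mem (L.smul_mem _ he₀L) (L.smul_mem _ he₁L)
  constructor
  · intro hv
    by_contra h
    rw [← hsum, Submodule.add_mem_iff_right _ hmem, Submodule.smul_mem_iff _ h] at hv
    exact he₂ hv
  · intro h
    rw [← hsum, h, zero_smul, add_zero]
    exact hmem

end Geometry

namespace Module.Basis

variable {F V : Type*} [Field F] [AddCommGroup V] [Module F V] (e : Basis (Fin 3) F V)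

/-- The affine point with coordinates `s = (a, b)`, off the line `⟨e 0, e 1⟩`. -/
def affinePoint (s : F × F) : Submodule F V :=
  Submodule.span F {s.2 • e 0 + s.1 • e 1 + e 2}

/-- The affine line `b = x + a * y`, which does not pass through `⟨e 0⟩`. -/
noncomputable def affineLine (x y : F) : Submodule F V :=
  LinearMap.ker (e.coord 0 - y • e.coord 1 - x • e.coord 2)

lemma mem_affineLine {x y : F} {v : V} :
    v ∈ e.affineLine x y ↔ e.repr v 0 = x * e.repr v 2 + y * e.repr v 1 := by
  rw [affineLine, LinearMap.mem_ker]
  simp only [LinearMap.sub_apply, LinearMap.smul_apply, coord_apply, smul_eq_mul]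
  constructor <;> intro h <;> linear_combination h

lemma repr_affine (a b : F) : (e.repr (b • e 0 + a • e 1 + e 2) 0 = b ∧
    e.repr (b • e 0 + a • e 1 + e 2) 1 = a) ∧ e.repr (b • e 0 + a • e 1 + e 2) 2 = 1 := by
  simp

lemma affinePoint_le_affineLine {s : F × F} {x y : F} :
    e.affinePoint s ≤ e.affineLine x y ↔ s.2 = x + s.1 * y := by
  rw [affinePoint, Submodule.span_singleton_le_iff_mem, mem_affineLine, (e.repr_affine _ _).1.1,
    (e.repr_affine _ _).1.2, (e.repr_affine _ _).2, mul_one, mul_comm y]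

lemma affinePoint_injective : Function.Injective e.affinePoint := by
  intro s t hst
  have hs : s.2 • e 0 + s.1 • e 1 + e 2 ∈ e.affinePoint t :=
    hst ▸ Submodule.mem_span_singleton_self _
  obtain ⟨c, hc⟩ := Submodule.mem_span_singleton.1 hs
  have h := fun i => congrArg (fun v => e.repr v i) hc
  have h0 := h 0
  have h1 := h 1
  have h2 := h 2
  simp only [map_smul, Finsupp.smul_apply, e.repr_affine, smul_eq_mul, mul_one] at h0 h1 h2
  subst h2
  rw [one_mul] at h0 h1
  exact Prod.ext h1.symm h0.symm

lemma exists_affinePoint_eq {P L : Submodule F V} (hL : ∀ v, v ∈ L ↔ e.repr v 2 = 0)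
    (hP : finrank F P = 1) (hPL : ¬ P ≤ L) : ∃ s, e.affinePoint s = P := by
  obtain ⟨v, -, rfl⟩ := Submodule.exists_eq_span_singleton_of_finrank_eq_one hP
  rw [Submodule.span_singleton_le_iff_mem, hL] at hPL
  refine ⟨((e.repr v 2)⁻¹ * e.repr v 1, (e.repr v 2)⁻¹ * e.repr v 0), ?_⟩
  rw [affinePoint, ← Submodule.span_singleton_smul_eq (IsUnit.mk0 _ (inv_ne_zero hPL)) v]
  congr 2
  apply e.repr.injective
  ext i
  fin_cases i <;> simp [hPL]

lemma affinePoint_not_le {L : Submodule F V} (hL : ∀ v, v ∈ L ↔ e.repr v 2 = 0) (s : F × F) :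
    ¬ e.affinePoint s ≤ L := by
  rw [affinePoint, Submodule.span_singleton_le_iff_mem, hL, (e.repr_affine _ _).2]
  exact one_ne_zero

lemma finrank_affineLine (x y : F) : finrank F (e.affineLine x y) = 2 := by
  have := e.finiteDimensional_of_finite
  have hne : e.coord 0 - y • e.coord 1 - x • e.coord 2 ≠ 0 := fun h => by
    have := LinearMap.congr_fun h (e 0)
    simp at this
  have h := Module.Dual.finrank_ker_add_one_of_ne_zero hne
  rw [finrank_eq_card_basis e, Fintype.card_fin] at h
  exact Nat.succ_injective h

lemma notMem_affineLine (x y : F) : e 0 ∉ e.affineLine x y := by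
  rw [mem_affineLine]
  simp

lemma exists_affineLine_eq {L : Submodule F V} (hL : finrank F L = 2) (h0 : e 0 ∉ L) :
    ∃ x y, e.affineLine x y = L := by
  have := e.finiteDimensional_of_finite
  obtain ⟨φ, hφ0, hφ⟩ := Submodule.exists_le_ker_of_lt_top L (lt_top_iff_ne_top.2 fun h =>
    h0 (h ▸ Submodule.mem_top))
  have hker : L = LinearMap.ker φ := by
    have h := Module.Dual.finrank_ker_add_one_of_ne_zero hφ0
    rw [finrank_eq_card_basis e, Fintype.card_fin] at h
    exact Submodule.eq_of_le_of_finrank_eq hφ (by omega)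
  subst hker
  rw [LinearMap.mem_ker] at h0
  refine ⟨-φ (e 2) / φ (e 0), -φ (e 1) / φ (e 0), ?_⟩
  ext v
  have hv := congrArg φ (e.sum_repr v)
  simp only [Fin.sum_univ_three, map_add, map_smul, smul_eq_mul] at hv
  rw [mem_affineLine, LinearMap.mem_ker, ← hv]
  field_simp
  constructor <;> intro h <;> linear_combination h

end Module.Basis

section BlockingSet

variable {F V : Type*} [Field F] [AddCommGroup V] [Module F V]

/-- Every point of a minimal blocking set lies on a tangent line. -/
lemma exists_tangent_of_minimal {B : Set (Submodule F V)}
    (hblock : ∀ L : Submodule F V, finrank F L = 2 → ∃ P ∈ B, P ≤ L)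
    (hmin : ∀ B' ⊂ B, ¬ ∀ L : Submodule F V, finrank F L = 2 → ∃ P ∈ B', P ≤ L)
    {Q : Submodule F V} (hQ : Q ∈ B) :
    ∃ L : Submodule F V, finrank F L = 2 ∧ Q ≤ L ∧ ∀ P ∈ B, P ≤ L → P = Q := by
  have h := hmin (B \ {Q}) (Set.sdiff_singleton_ssubset.2 hQ)
  push Not at h
  obtain ⟨L, hL, h⟩ := h
  have htan : ∀ P ∈ B, P ≤ L → P = Q := fun P hP hPL => by
    by_contra hne
    exact h P ⟨hP, hne⟩ hPL
  obtain ⟨P, hP, hPL⟩ := hblock L hL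
  exact ⟨L, hL, htan P hP hPL ▸ hPL, htan⟩

/-- A line has `q + 1` points. -/
lemma ncard_points_of_finrank_two [Finite F] {L : Submodule F V} (hL : finrank F L = 2) :
    {P : Submodule F V | finrank F P = 1 ∧ P ≤ L}.ncard = Nat.card F + 1 := by
  rw [← Projectivization.card_of_finrank_two F L hL,
    Nat.card_congr (Projectivization.equivSubmodule F L), ← Nat.card_coe_set_eq]
  refine Nat.card_congr
    { toFun := fun P => ⟨P.1.comap L.subtype, ?_⟩
      invFun := fun P => ⟨P.1.map L.subtype, ?_, Submodule.map_subtype_le _ _⟩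
      left_inv := fun P => ?_
      right_inv := fun P => ?_ }
  · rw [← Submodule.finrank_map_subtype_eq, Submodule.map_comap_subtype, inf_eq_right.2 P.2.2, P.2.1]
  · rw [Submodule.finrank_map_subtype_eq, P.2]
  · ext1
    exact (Submodule.map_comap_subtype _ _).trans (inf_eq_right.2 P.2.2)
  · ext1
    exact Submodule.comap_map_eq_of_injective L.subtype_injective P.1

/-- A blocking set contained in a line contains every point of this line. -/
lemma mem_of_forall_le_line [FiniteDimensional F V] (hV : finrank F V = 3)
    {B : Set (Submodule F V)} (hBpts : ∀ P ∈ B, finrank F P = 1)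
    (hblock : ∀ L : Submodule F V, finrank F L = 2 → ∃ P ∈ B, P ≤ L)
    {L : Submodule F V} (hL : finrank F L = 2) (hBL : ∀ P ∈ B, P ≤ L)
    {P : Submodule F V} (hP : finrank F P = 1) (hPL : P ≤ L) : P ∈ B := by
  obtain ⟨v, hv⟩ : ∃ v, v ∉ L := by
    by_contra! h
    rw [(Submodule.eq_top_iff').2 h, finrank_top] at hL
    omega
  have hv0 : v ≠ 0 := fun h => hv (h ▸ L.zero_mem)
  have hdisj : Submodule.span F {v} ⊓ L = ⊥ :=
    ((Submodule.disjoint_span_singleton' hv0).2 hv).symm.eq_bot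
  have hM : finrank F ↥(P ⊔ Submodule.span F {v}) = 2 := by
    have h := Submodule.finrank_sup_add_finrank_inf_eq P (Submodule.span F {v})
    have h' : P ⊓ Submodule.span F {v} = ⊥ := by
      rw [eq_bot_iff, ← hdisj, inf_comm]
      exact inf_le_inf_left _ hPL
    rw [h', finrank_bot, hP, finrank_span_singleton hv0] at h
    exact h
  obtain ⟨Q, hQ, hQM⟩ := hblock _ hM
  have hQP : Q ≤ P := by
    have h := le_inf hQM (hBL Q hQ)
    rwa [sup_inf_assoc_of_le _ hPL, hdisj, sup_bot_eq] at h
  exact Submodule.eq_of_le_of_finrank_eq_one (hBpts Q hQ) hP hQP ▸ hQ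

end BlockingSet

/-- Szőnyi, 1997: a minimal small blocking set of `PG(2,q)`, `q = p^h`, meets every
line in `1 mod p` points. -/
theorem small_minimal_blocking_set_mod_p (p h : ℕ) (hp : p.Prime) (hh : 0 < h)
    (F : Type) [Field F] [Fintype F] (hF : Fintype.card F = p ^ h)
    (B : Set (Submodule F (Fin 3 → F)))
    (hBpts : ∀ P ∈ B, finrank F P = 1)
    (hblock : ∀ L : Submodule F (Fin 3 → F), finrank F L = 2 → ∃ P ∈ B, P ≤ L)
    (hmin : ∀ B' ⊂ B, ¬ ∀ L : Submodule F (Fin 3 → F), finrank F L = 2 → ∃ P ∈ B', P ≤ L)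
    (hsmall : 2 * B.ncard < 3 * (p ^ h + 1)) :
    ∀ L : Submodule F (Fin 3 → F), finrank F L = 2 →
      Set.ncard {P ∈ B | P ≤ L} ≡ 1 [MOD p] := by
  classical
  intro L hL
  have : Fact p.Prime := ⟨hp⟩
  have hchar : CharP F p := by
    have : CharP F (ringChar F) := ringChar.charP F
    obtain ⟨n, hr, hn⟩ := FiniteField.card F (ringChar F)
    rw [hF] at hn
    have : ringChar F = p := ((Nat.prime_dvd_prime_iff_eq hr hp).1
      (hr.dvd_of_dvd_pow (hn ▸ dvd_pow_self _ n.ne_zero)))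
    rwa [← this]
  have hV : finrank F (Fin 3 → F) = 3 := by simp
  by_cases hBL : ∀ P ∈ B, P ≤ L
  · have hB : {P ∈ B | P ≤ L} = {P : Submodule F (Fin 3 → F) | finrank F P = 1 ∧ P ≤ L} := by
      ext P
      exact ⟨fun h => ⟨hBpts P h.1, h.2⟩,
        fun h => ⟨mem_of_forall_le_line hV hBpts hblock hL hBL h.1 h.2, h.2⟩⟩
    rw [hB, ncard_points_of_finrank_two hL, Nat.card_eq_fintype_card, hF]
    simpa using ((Nat.modEq_zero_iff_dvd).2 (dvd_pow_self p hh.ne')).add_right 1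
  push Not at hBL
  obtain ⟨Q, hQ, hQL⟩ := hBL
  obtain ⟨M, hM, hQM, htan⟩ := exists_tangent_of_minimal hblock hmin hQ
  obtain ⟨e, rfl, heM⟩ := exists_basis_of_flag hV (hBpts Q hQ) hM hQM
  rw [Submodule.span_singleton_le_iff_mem] at hQL
  let S : Finset (F × F) := Finset.univ.filter fun s => e.affinePoint s ∈ B
  have hS : ∀ s, s ∈ S ↔ e.affinePoint s ∈ B := fun s => by simp [S]
  have haff : ∀ P ∈ B, ∀ L : Submodule F (Fin 3 → F), P ≤ L → e 0 ∉ L →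
      ∃ s ∈ S, e.affinePoint s = P := fun P hP L hPL h0 => by
    obtain ⟨s, hs⟩ := e.exists_affinePoint_eq heM (hBpts P hP) fun h => h0 <| by
      rw [← Submodule.span_singleton_le_iff_mem, ← htan P hP h]
      exact hPL
    exact ⟨s, (hS s).2 (hs ▸ hP), hs⟩
  have hcard : S.card + 1 ≤ B.ncard := by
    have himg : insert (Submodule.span F {e 0}) (e.affinePoint '' S) ⊆ B := by
      rintro _ (rfl | ⟨s, hs, rfl⟩)
      · exact hQ
      · exact (hS s).1 hs
    have h := Set.ncard_le_ncard himg (Set.toFinite B)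
    rwa [Set.ncard_insert_of_notMem, Set.ncard_image_of_injective _ e.affinePoint_injective,
      Set.ncard_coe_finset] at h
    rintro ⟨s, -, hs⟩
    exact e.affinePoint_not_le heM s (hs ▸ hQM)
  obtain ⟨x, y, rfl⟩ := e.exists_affineLine_eq hL hQL
  have hcount : {P ∈ B | P ≤ e.affineLine x y} =
      e.affinePoint '' (S.filter fun s => s.2 = x + s.1 * y) := by
    ext P
    constructor
    · rintro ⟨hP, hPL⟩
      obtain ⟨s, hs, rfl⟩ := haff P hP _ hPL hQL
      exact ⟨s, by simpa [hs] using e.affinePoint_le_affineLine.1 hPL, rfl⟩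
    · rintro ⟨s, hs, rfl⟩
      rw [Finset.mem_coe, Finset.mem_filter] at hs
      exact ⟨(hS s).1 hs.1, e.affinePoint_le_affineLine.2 hs.2⟩
  rw [hcount, Set.ncard_image_of_injective _ e.affinePoint_injective, Set.ncard_coe_finset]
  refine affine_card_filter_modEq_one S (fun x y => ?_) (fun s hs => ?_) (by rw [hF]; omega) x y
  · obtain ⟨P, hP, hPL⟩ := hblock _ (e.finrank_affineLine x y)
    obtain ⟨s, hs, rfl⟩ := haff P hP _ hPL (e.notMem_affineLine x y)
    exact ⟨s, hs, e.affinePoint_le_affineLine.1 hPL⟩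
  · obtain ⟨N, hN, hsN, hNtan⟩ := exists_tangent_of_minimal hblock hmin ((hS s).1 hs)
    have h0 : e 0 ∉ N := fun h => by
      have := hNtan _ hQ ((Submodule.span_singleton_le_iff_mem _ _).2 h)
      exact e.affinePoint_not_le heM s (this ▸ hQM)
    obtain ⟨x, y, rfl⟩ := e.exists_affineLine_eq hN h0
    refine ⟨x, y, e.affinePoint_le_affineLine.1 hsN, fun t ht hxy => ?_⟩
    exact e.affinePoint_injective (hNtan _ ((hS t).1 ht) (e.affinePoint_le_affineLine.2 hxy))
end

section
/- Let q be an odd prime power and let B be a set of points of PG(2,q) such that every line contains at most 2 points of B. Then |B| ≤ q + 1. Moreover, if |B| = q + 1, then B is a conic: there exists a quadratic form Q on GF(q)^3 whose associated bilinear form is nondegenerate, such that B is exactly the set of points of PG(2,q) spanned by nonzero vectors v with Q(v) = 0. -/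
open Module

section Arc

theorem card_sdiff_triple {α : Type*} [DecidableEq α] {S : Finset α} {x y z : α}
    (hx : x ∈ S) (hy : y ∈ S) (hz : z ∈ S) (hxy : x ≠ y) (hyz : y ≠ z) (hxz : x ≠ z) :
    (S \ {x, y, z}).card + 3 = S.card := by
  have h : ({x, y, z} : Finset α).card = 3 := Finset.card_eq_three.2
    ⟨x, y, z, hxy, hxz, hyz, rfl⟩
  have hsub : {x, y, z} ⊆ S := by
    intro a
    simp only [Finset.mem_insert, Finset.mem_singleton]
    rintro (rfl | rfl | rfl) <;> assumption
  rw [← Finset.card_sdiff_add_card_eq_card hsub, h]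

theorem triple_rotate {α : Type*} [DecidableEq α] (x y z : α) :
    ({y, z, x} : Finset α) = {x, y, z} := by
  ext; simp only [Finset.mem_insert, Finset.mem_singleton]; tauto

variable {F : Type*} [Field F]

theorem two_ne_zero_of_odd_card [Fintype F] (hodd : Odd (Fintype.card F)) : (2 : F) ≠ 0 := by
  refine Ring.two_ne_zero fun h => ?_
  have := FiniteField.even_card_of_char_two h
  have := Nat.odd_iff.1 hodd
  omega

/-- The linear form `w ↦ det (u, v, w)` on `F³`. -/
def detForm (u v : Fin 3 → F) : Module.Dual F (Fin 3 → F) where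
  toFun w := (Matrix.of ![u, v, w]).det
  map_add' a b := by simp [Matrix.det_fin_three]; ring
  map_smul' c a := by simp [Matrix.det_fin_three]; ring

theorem detForm_apply (u v w : Fin 3 → F) :
    detForm u v w = u 0 * v 1 * w 2 - u 0 * v 2 * w 1 - u 1 * v 0 * w 2 + u 1 * v 2 * w 0
      + u 2 * v 0 * w 1 - u 2 * v 1 * w 0 := by
  simp [detForm, Matrix.det_fin_three]

theorem detForm_rotate (u v w : Fin 3 → F) : detForm u v w = detForm v w u := by
  simp only [detForm_apply]; ring

@[simp] theorem detForm_self_left (u v : Fin 3 → F) : detForm u v u = 0 := by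
  simp only [detForm_apply]; ring

@[simp] theorem detForm_self_right (u v : Fin 3 → F) : detForm u v v = 0 := by
  simp only [detForm_apply]; ring

theorem detForm_ne_zero_iff_linearIndependent (u v w : Fin 3 → F) :
    detForm u v w ≠ 0 ↔ LinearIndependent F ![u, v, w] := by
  rw [← isUnit_iff_ne_zero]
  have h := Matrix.linearIndependent_rows_iff_isUnit (A := Matrix.of ![u, v, w])
  rw [Matrix.isUnit_iff_isUnit_det] at h
  exact h.symm

/-- Cramer's rule in `F³`. -/
theorem detForm_smul_eq (x y z v : Fin 3 → F) :
    detForm x y z • v = detForm y z v • x + detForm z x v • y + detForm x y v • z := by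
  ext i
  simp only [detForm_apply, Pi.add_apply, Pi.smul_apply, smul_eq_mul]
  fin_cases i <;> simp <;> ring

theorem detForm_mul_dual (f : Module.Dual F (Fin 3 → F)) (x y z v : Fin 3 → F) :
    detForm x y z * f v = detForm y z v * f x + detForm z x v * f y + detForm x y v * f z := by
  simpa using congrArg f (detForm_smul_eq x y z v)

theorem detForm_plucker (x y z p r : Fin 3 → F) :
    detForm z x p * detForm x y r - detForm z x r * detForm x y p
      = detForm x y z * detForm x p r := by
  simp only [detForm_apply]; ring

/-- A finite set of vectors of `F³`, any three of which are linearly independent. -/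
def IsVectorArc (S : Finset (Fin 3 → F)) : Prop :=
  ∀ x ∈ S, ∀ y ∈ S, ∀ z ∈ S, x ≠ y → y ≠ z → x ≠ z → detForm x y z ≠ 0

/-- The slope of the line `xp` relative to the lines `xy` and `xz`. -/
def slopeAt (x y z p : Fin 3 → F) : F := detForm z x p / detForm x y p

theorem slopeAt_mul_cyclic {x y z p : Fin 3 → F} (h₁ : detForm x y p ≠ 0)
    (h₂ : detForm y z p ≠ 0) (h₃ : detForm z x p ≠ 0) :
    slopeAt x y z p * slopeAt y z x p * slopeAt z x y p = 1 := by
  unfold slopeAt; field_simp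

variable {S : Finset (Fin 3 → F)}

theorem IsVectorArc.slopeAt_injOn (hS : IsVectorArc S) {x y z : Fin 3 → F}
    (hx : x ∈ S) (hy : y ∈ S) (hz : z ∈ S) (hxy : x ≠ y) (hyz : y ≠ z) (hxz : x ≠ z)
    {p r : Fin 3 → F} (hp : p ∈ S) (hr : r ∈ S) (hpx : p ≠ x) (hpy : p ≠ y)
    (hrx : r ≠ x) (hry : r ≠ y) (h : slopeAt x y z p = slopeAt x y z r) : p = r := by
  by_contra hpr
  have h₁ := hS x hx y hy p hp hxy hpy.symm hpx.symm
  have h₂ := hS x hx y hy r hr hxy hry.symm hrx.symm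
  unfold slopeAt at h
  rw [div_eq_div_iff h₁ h₂] at h
  have := detForm_plucker x y z p r
  rw [h, sub_self, eq_comm] at this
  exact mul_ne_zero (hS x hx y hy z hz hxy hyz hxz) (hS x hx p hp r hr hpx.symm hpr hrx.symm) this

variable [DecidableEq F]

theorem IsVectorArc.slopeAt_injOn_sdiff (hS : IsVectorArc S) {x y z : Fin 3 → F}
    (hx : x ∈ S) (hy : y ∈ S) (hz : z ∈ S) (hxy : x ≠ y) (hyz : y ≠ z) (hxz : x ≠ z) :
    Set.InjOn (slopeAt x y z) (S \ {x, y, z} : Finset _) := by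
  intro p hp r hr h
  simp only [Finset.coe_sdiff, Set.mem_sdiff, Finset.mem_coe, Finset.mem_insert,
    Finset.mem_singleton, not_or] at hp hr
  exact hS.slopeAt_injOn hx hy hz hxy hyz hxz hp.1 hr.1 hp.2.1 hp.2.2.1 hr.2.1 hr.2.2.1 h

theorem IsVectorArc.slopeAt_ne_zero (hS : IsVectorArc S) {x y z : Fin 3 → F}
    (hx : x ∈ S) (hy : y ∈ S) (hz : z ∈ S) (hxy : x ≠ y) (hxz : x ≠ z)
    {p : Fin 3 → F} (hp : p ∈ S \ {x, y, z}) : slopeAt x y z p ≠ 0 := by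
  simp only [Finset.mem_sdiff, Finset.mem_insert, Finset.mem_singleton, not_or] at hp
  obtain ⟨hp, hpx, hpy, hpz⟩ := hp
  exact div_ne_zero (hS z hz x hx p hp hxz.symm (Ne.symm hpx) (Ne.symm hpz))
    (hS x hx y hy p hp hxy (Ne.symm hpy) (Ne.symm hpx))

theorem IsVectorArc.prod_slopeAt_cyclic (hS : IsVectorArc S) {x y z : Fin 3 → F}
    (hx : x ∈ S) (hy : y ∈ S) (hz : z ∈ S) (hxy : x ≠ y) (hyz : y ≠ z) (hxz : x ≠ z) :
    (∏ p ∈ S \ {x, y, z}, slopeAt x y z p) * (∏ p ∈ S \ {x, y, z}, slopeAt y z x p) *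
      (∏ p ∈ S \ {x, y, z}, slopeAt z x y p) = 1 := by
  rw [← Finset.prod_mul_distrib, ← Finset.prod_mul_distrib]
  refine Finset.prod_eq_one fun p hp => ?_
  simp only [Finset.mem_sdiff, Finset.mem_insert, Finset.mem_singleton, not_or] at hp
  obtain ⟨hp, hpx, hpy, hpz⟩ := hp
  exact slopeAt_mul_cyclic (hS x hx y hy p hp hxy (Ne.symm hpy) (Ne.symm hpx))
    (hS y hy z hz p hp hyz (Ne.symm hpz) (Ne.symm hpy))
    (hS z hz x hx p hp hxz.symm (Ne.symm hpx) (Ne.symm hpz))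

theorem IsVectorArc.insert (hS : IsVectorArc S) {w : Fin 3 → F}
    (hw : ∀ u ∈ S, ∀ v ∈ S, u ≠ v → detForm u v w ≠ 0) : IsVectorArc (insert w S) := by
  intro x hx y hy z hz hxy hyz hxz
  rw [Finset.mem_insert] at hx hy hz
  rcases hx with rfl | hx
  · rw [detForm_rotate]
    exact hw y (hy.resolve_left hxy.symm) z (hz.resolve_left hxz.symm) hyz
  rcases hy with rfl | hy
  · rw [detForm_rotate, detForm_rotate]
    exact hw z (hz.resolve_left hyz.symm) x hx hxz.symm
  rcases hz with rfl | hz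
  · exact hw x hx y hy hxy
  · exact hS x hx y hy z hz hxy hyz hxz

variable [Fintype F]

theorem prod_eq_neg_one_of_card {ι : Type*} {T : Finset ι} {g : ι → F}
    (hinj : Set.InjOn g T) (h0 : ∀ i ∈ T, g i ≠ 0) (hcard : T.card + 1 = Fintype.card F) :
    ∏ i ∈ T, g i = -1 := by
  have him : T.image g = Finset.univ.erase 0 := by
    apply Finset.eq_of_subset_of_card_le
    · intro a ha
      obtain ⟨i, hi, rfl⟩ := Finset.mem_image.1 ha
      simpa using h0 i hi
    · rw [Finset.card_image_of_injOn hinj, Finset.card_erase_of_mem (Finset.mem_univ _),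
        Finset.card_univ]
      omega
  have hunits := congrArg Units.val (FiniteField.prod_univ_units_id_eq_neg_one (K := F))
  rw [Units.coe_prod, Units.val_neg, Units.val_one] at hunits
  rw [← Finset.prod_image (f := fun a => a) hinj, him, ← hunits]
  symm
  refine Finset.prod_bij (fun u _ => (u : F)) (by simp) (fun _ _ _ _ h => Units.ext h)
    (fun a ha => ?_) (fun _ _ => rfl)
  exact ⟨Units.mk0 a (Finset.ne_of_mem_erase ha), Finset.mem_univ _, rfl⟩

/-- In odd characteristic there is no hyperoval. -/
theorem IsVectorArc.card_ne (hS : IsVectorArc S) (hodd : Odd (Fintype.card F)) :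
    S.card ≠ Fintype.card F + 2 := by
  intro hcard
  have h2 : (2 : F) ≠ 0 := two_ne_zero_of_odd_card hodd
  obtain ⟨x, hx, y, hy, z, hz, hxy, hxz, hyz⟩ := Finset.two_lt_card.1
    (by have := hodd.pos; omega : 2 < S.card)
  have hT := card_sdiff_triple hx hy hz hxy hyz hxz
  have h := hS.prod_slopeAt_cyclic hx hy hz hxy hyz hxz
  rw [prod_eq_neg_one_of_card (hS.slopeAt_injOn_sdiff hx hy hz hxy hyz hxz)
    (fun p hp => hS.slopeAt_ne_zero hx hy hz hxy hxz hp) (by omega)] at h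
  rw [← triple_rotate] at hT h
  rw [prod_eq_neg_one_of_card (hS.slopeAt_injOn_sdiff hy hz hx hyz hxz.symm hxy.symm)
    (fun p hp => hS.slopeAt_ne_zero hy hz hx hyz hxy.symm hp) (by omega)] at h
  rw [← triple_rotate] at hT h
  rw [prod_eq_neg_one_of_card (hS.slopeAt_injOn_sdiff hz hx hy hxz.symm hxy hyz.symm)
    (fun p hp => hS.slopeAt_ne_zero hz hx hy hxz.symm hyz.symm hp) (by omega)] at h
  apply h2
  linear_combination -h

theorem IsVectorArc.card_le_add_two (hS : IsVectorArc S) : S.card ≤ Fintype.card F + 2 := by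
  by_contra! hcard
  obtain ⟨x, hx, y, hy, z, hz, hxy, hxz, hyz⟩ := Finset.two_lt_card.1
    (by omega : 2 < S.card)
  have hT := card_sdiff_triple hx hy hz hxy hyz hxz
  have h0 : (0 : F) ∉ (S \ {x, y, z}).image (slopeAt x y z) := by
    rw [Finset.mem_image]
    rintro ⟨p, hp, h⟩
    exact hS.slopeAt_ne_zero hx hy hz hxy hxz hp h
  have := Finset.card_lt_univ_of_notMem h0
  rw [Finset.card_image_of_injOn (hS.slopeAt_injOn_sdiff hx hy hz hxy hyz hxz)] at this
  omega

theorem IsVectorArc.card_le (hS : IsVectorArc S) (hodd : Odd (Fintype.card F)) :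
    S.card ≤ Fintype.card F + 1 := by
  have h₁ := hS.card_le_add_two
  have h₂ := hS.card_ne hodd
  omega

/-- The form `f` defines a line meeting `S` in the single vector `x`. -/
def IsTangentForm (S : Finset (Fin 3 → F)) (x : Fin 3 → F) (f : Module.Dual F (Fin 3 → F)) :
    Prop :=
  f x = 0 ∧ ∀ y ∈ S, y ≠ x → f y ≠ 0

theorem IsVectorArc.exists_isTangentForm (hS : IsVectorArc S) (hcard : S.card = Fintype.card F + 1)
    {x : Fin 3 → F} (hx : x ∈ S) : ∃ f, IsTangentForm S x f := by
  have hF := Fintype.one_lt_card (α := F)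
  obtain ⟨y, hy, z, hz, hyz⟩ := Finset.one_lt_card.1
    (by rw [Finset.card_erase_of_mem hx]; omega : 1 < (S.erase x).card)
  rw [Finset.mem_erase] at hy hz
  obtain ⟨hyx, hy⟩ := hy
  obtain ⟨hzx, hz⟩ := hz
  have hU : ((S.erase x).erase y).card < (Finset.univ : Finset F).card := by
    rw [Finset.card_erase_of_mem (by simp [hyx, hy]), Finset.card_erase_of_mem hx,
      Finset.card_univ]
    omega
  obtain ⟨t, -, ht⟩ := Finset.exists_mem_notMem_of_card_lt_card
    ((Finset.card_image_le (f := slopeAt x y z)).trans_lt hU)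
  refine ⟨detForm z x - t • detForm x y, by simp, fun p hp hpx h => ?_⟩
  simp only [LinearMap.sub_apply, LinearMap.smul_apply, smul_eq_mul] at h
  by_cases hpy : p = y
  · subst hpy
    simp only [detForm_self_right, mul_zero, sub_zero] at h
    exact hS z hz x hx p hy hzx hyx.symm hyz.symm h
  · refine ht (Finset.mem_image.2 ⟨p, by simp [hpy, hpx, hp], ?_⟩)
    rw [slopeAt, div_eq_iff (hS x hx y hy p hp hyx.symm (Ne.symm hpy) (Ne.symm hpx))]
    linear_combination h

theorem IsVectorArc.prod_slopeAt_of_isTangentForm (hS : IsVectorArc S)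
    (hcard : S.card = Fintype.card F + 1) {x y z : Fin 3 → F}
    (hx : x ∈ S) (hy : y ∈ S) (hz : z ∈ S) (hxy : x ≠ y) (hyz : y ≠ z) (hxz : x ≠ z)
    {f : Module.Dual F (Fin 3 → F)} (hf : IsTangentForm S x f) :
    f z * ∏ p ∈ S \ {x, y, z}, slopeAt x y z p = f y := by
  have hT := card_sdiff_triple hx hy hz hxy hyz hxz
  have hfy := hf.2 y hy hxy.symm
  have hfz := hf.2 z hz hxz.symm
  have hne : ∀ p ∈ S \ {x, y, z}, slopeAt x y z p ≠ -f z / f y := by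
    intro p hp h
    simp only [Finset.mem_sdiff, Finset.mem_insert, Finset.mem_singleton, not_or] at hp
    obtain ⟨hp, hpx, hpy, hpz⟩ := hp
    rw [slopeAt, div_eq_div_iff (hS x hx y hy p hp hxy (Ne.symm hpy) (Ne.symm hpx)) hfy] at h
    have := detForm_mul_dual f x y z p
    rw [hf.1, h] at this
    refine mul_ne_zero (hS x hx y hy z hz hxy hyz hxz) (hf.2 p hp hpx) ?_
    rw [this]; ring
  have hprod := prod_eq_neg_one_of_card (T := Finset.insertNone (S \ {x, y, z}))
    (g := fun o => o.elim (-f z / f y) (slopeAt x y z)) ?_ ?_ ?_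
  · rw [Finset.prod_insertNone] at hprod
    simp only [Option.elim] at hprod
    field_simp at hprod
    linear_combination -hprod
  · rintro (_ | p) hp (_ | r) hr h
    · rfl
    · exact absurd h.symm (hne r (Finset.some_mem_insertNone.1 hr))
    · exact absurd h (hne p (Finset.some_mem_insertNone.1 hp))
    · rw [hS.slopeAt_injOn_sdiff hx hy hz hxy hyz hxz (Finset.some_mem_insertNone.1 hp)
        (Finset.some_mem_insertNone.1 hr) h]
  · rintro (_ | p) hp
    · exact div_ne_zero (neg_ne_zero.2 hfz) hfy
    · exact hS.slopeAt_ne_zero hx hy hz hxy hxz (Finset.some_mem_insertNone.1 hp)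
  · rw [Finset.card_insertNone]; omega

/-- Segre's lemma of tangents. -/
theorem IsVectorArc.lemma_of_tangents (hS : IsVectorArc S)
    (hcard : S.card = Fintype.card F + 1) {x y z : Fin 3 → F}
    (hx : x ∈ S) (hy : y ∈ S) (hz : z ∈ S) (hxy : x ≠ y) (hyz : y ≠ z) (hxz : x ≠ z)
    {f g h : Module.Dual F (Fin 3 → F)} (hf : IsTangentForm S x f) (hg : IsTangentForm S y g)
    (hh : IsTangentForm S z h) : f y * g z * h x = f z * g x * h y := by
  have h₀ := hS.prod_slopeAt_cyclic hx hy hz hxy hyz hxz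
  have h₁ := hS.prod_slopeAt_of_isTangentForm hcard hx hy hz hxy hyz hxz hf
  have h₂ := hS.prod_slopeAt_of_isTangentForm hcard hy hz hx hyz hxz.symm hxy.symm hg
  have h₃ := hS.prod_slopeAt_of_isTangentForm hcard hz hx hy hxz.symm hxy hyz.symm hh
  rw [triple_rotate] at h₂
  rw [triple_rotate, triple_rotate] at h₃
  rw [← h₁, ← h₂, ← h₃]
  linear_combination (f z * g x * h y) * h₀

/-- The tangent forms can be scaled so that `(x, y) ↦ g x y` is symmetric on the arc. -/
theorem IsVectorArc.exists_symmetric_tangentForms (hS : IsVectorArc S)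
    (hcard : S.card = Fintype.card F + 1) :
    ∃ g : (Fin 3 → F) → Module.Dual F (Fin 3 → F),
      (∀ x ∈ S, IsTangentForm S x (g x)) ∧ ∀ x ∈ S, ∀ y ∈ S, g x y = g y x := by
  choose! f hf using fun x (hx : x ∈ S) => hS.exists_isTangentForm hcard hx
  obtain ⟨e, he⟩ : S.Nonempty := Finset.card_pos.1 (by omega)
  have hfe : ∀ x ∈ S, x ≠ e → f x e ≠ 0 ∧ f e x ≠ 0 := fun x hx hxe =>
    ⟨(hf x hx).2 e he hxe.symm, (hf e he).2 x hx hxe⟩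
  refine ⟨fun x => if x = e then f e else (f e x / f x e) • f x, fun x hx => ?_,
    fun x hx y hy => ?_⟩
  · dsimp only
    split_ifs with hxe
    · exact hxe ▸ hf e he
    · obtain ⟨h₁, h₂⟩ := hfe x hx hxe
      refine ⟨by simp [(hf x hx).1], fun y hy hyx => ?_⟩
      simpa [h₁, h₂] using (hf x hx).2 y hy hyx
  · dsimp only
    split_ifs with hxe hye hye
    · rw [hxe, hye]
    · subst hxe
      have := hfe y hy hye
      simp [this.1]
    · subst hye
      have := hfe x hx hxe
      simp [this.1]
    · by_cases hxy : x = y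
      · rw [hxy]
      obtain ⟨h₁, h₂⟩ := hfe x hx hxe
      obtain ⟨h₃, h₄⟩ := hfe y hy hye
      have := hS.lemma_of_tangents hcard he hx hy (Ne.symm hxe) hxy (Ne.symm hye) (hf e he)
        (hf x hx) (hf y hy)
      simp only [LinearMap.smul_apply, smul_eq_mul]
      field_simp
      linear_combination this

/-- Segre's theorem for sets of vectors. -/
theorem IsVectorArc.exists_quadraticForm (hS : IsVectorArc S) (hodd : Odd (Fintype.card F))
    (hcard : S.card = Fintype.card F + 1) :
    ∃ Q : QuadraticForm F (Fin 3 → F), (QuadraticMap.polarBilin Q).Nondegenerate ∧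
      (∀ x ∈ S, Q x = 0) ∧ ∀ w ≠ 0, Q w = 0 → ∃ x ∈ S, ∃ c : F, w = c • x := by
  have h2 : (2 : F) ≠ 0 := two_ne_zero_of_odd_card hodd
  have hF := Fintype.one_lt_card (α := F)
  obtain ⟨g, hg, hsymm⟩ := hS.exists_symmetric_tangentForms hcard
  obtain ⟨a, ha, b, hb, c, hc, hab, hac, hbc⟩ := Finset.two_lt_card.1 (by omega : 2 < S.card)
  have hD := hS a ha b hb c hc hab hbc hac
  set Q : QuadraticForm F (Fin 3 → F) := QuadraticMap.linMulLin (g a) (detForm b c) +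
    QuadraticMap.linMulLin (g b) (detForm c a) + QuadraticMap.linMulLin (g c) (detForm a b) with hQ
  have hQapp : ∀ v, Q v = g a v * detForm b c v + g b v * detForm c a v + g c v * detForm a b v :=
    fun v => by simp [hQ]
  have hgS : ∀ x ∈ S, ∀ v, detForm a b c * g x v =
      detForm b c v * g a x + detForm c a v * g b x + detForm a b v * g c x := by
    intro x hx v
    rw [detForm_mul_dual, hsymm x hx a ha, hsymm x hx b hb, hsymm x hx c hc]
  have hQS : ∀ x ∈ S, Q x = 0 := by
    intro x hx
    have := hgS x hx x
    rw [(hg x hx).1] at this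
    rw [hQapp]
    linear_combination -this
  have hpolar : ∀ x ∈ S, ∀ v, QuadraticMap.polar Q x v = 2 * detForm a b c * g x v := by
    intro x hx v
    have hQxv : QuadraticMap.polar Q x v = g a x * detForm b c v + g a v * detForm b c x +
        (g b x * detForm c a v + g b v * detForm c a x) +
        (g c x * detForm a b v + g c v * detForm a b x) := by
      simp only [QuadraticMap.polar, hQapp, map_add]; ring
    apply mul_left_cancel₀ hD
    rw [hQxv]
    linear_combination (-2 * detForm a b c) * hgS x hx v
      + detForm b c x * hgS a ha v + detForm c a x * hgS b hb v + detForm a b x * hgS c hc v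
      - detForm b c v * detForm_mul_dual (g a) a b c x
      - detForm c a v * detForm_mul_dual (g b) a b c x
      - detForm a b v * detForm_mul_dual (g c) a b c x
  refine ⟨Q, ?_, hQS, ?_⟩
  · have hsep : ∀ v, (∀ w, QuadraticMap.polar Q w v = 0) → v = 0 := by
      intro v hv
      have hgv : ∀ x ∈ S, g x v = 0 := by
        intro x hx
        have := hv x
        rw [hpolar x hx] at this
        exact (mul_eq_zero.1 this).resolve_left (mul_ne_zero h2 hD)
      have h₁ := hgS a ha v
      have h₂ := hgS b hb v
      have h₃ := hgS c hc v
      rw [hgv a ha, (hg a ha).1, hsymm b hb a ha, hsymm c hc a ha] at h₁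
      rw [hgv b hb, (hg b hb).1, hsymm c hc b hb] at h₂
      rw [hgv c hc, (hg c hc).1] at h₃
      have hgab := (hg a ha).2 b hb hab.symm
      have hgac := (hg a ha).2 c hc hac.symm
      have hgbc := (hg b hb).2 c hc hbc.symm
      have hA : detForm b c v = 0 := by
        apply mul_left_cancel₀ (mul_ne_zero h2 (mul_ne_zero hgab hgac))
        linear_combination g b c * h₁ - g a c * h₂ - g a b * h₃
      have hB : detForm c a v = 0 := by
        apply mul_left_cancel₀ (mul_ne_zero h2 (mul_ne_zero hgab hgbc))
        linear_combination -g b c * h₁ + g a c * h₂ - g a b * h₃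
      have hC : detForm a b v = 0 := by
        apply mul_left_cancel₀ (mul_ne_zero h2 (mul_ne_zero hgac hgbc))
        linear_combination -g b c * h₁ - g a c * h₂ + g a b * h₃
      have hv0 := detForm_smul_eq a b c v
      rw [hA, hB, hC] at hv0
      simpa [hD] using hv0
    exact ⟨fun v hv => hsep v fun w => by rw [QuadraticMap.polar_comm]; exact hv w,
      fun v hv => hsep v hv⟩
  · intro w hw hQw
    by_contra! hcon
    have hwS : w ∉ S := fun h => hcon w h 1 (one_smul _ _).symm
    refine (hS.insert (w := w) fun u hu v hv huv hdet => ?_).card_ne hodd ?_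
    · obtain ⟨z, hz, hzu, hzv⟩ : ∃ z ∈ S, z ≠ u ∧ z ≠ v := by
        by_contra! hz
        have hsub : S ⊆ {u, v} := fun z h => by
          rw [Finset.mem_insert, Finset.mem_singleton, or_iff_not_imp_left]
          exact hz z h
        have := (Finset.card_le_card hsub).trans Finset.card_le_two
        omega
      have hne := hS u hu v hv z hz huv (Ne.symm hzv) (Ne.symm hzu)
      have hexp := detForm_smul_eq u v z w
      rw [hdet, zero_smul, add_zero] at hexp
      have hQexp := congrArg Q hexp
      rw [QuadraticMap.map_add Q, Q.map_smul, Q.map_smul, Q.map_smul, hQw, hQS u hu, hQS v hv,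
        QuadraticMap.polar_smul_left, QuadraticMap.polar_smul_right, hpolar u hu] at hQexp
      have hguv := (hg u hu).2 v hv huv.symm
      simp only [smul_eq_mul, mul_zero, add_zero, zero_add, zero_eq_mul, mul_eq_zero, h2, hD, hguv,
        or_false] at hQexp
      rcases hQexp with h | h
      · rw [h, zero_smul, zero_add] at hexp
        exact hcon v hv _ (by rw [mul_smul, ← hexp, inv_smul_smul₀ hne])
      · rw [h, zero_smul, add_zero] at hexp
        exact hcon u hu _ (by rw [mul_smul, ← hexp, inv_smul_smul₀ hne])
    · rw [Finset.card_insert_of_notMem hwS, hcard]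

end Arc

/-- Generators of three distinct points of an arc are linearly independent. -/
theorem linearIndependent_of_arc {F : Type*} [Field F] [Fintype F]
    {B : Set (Submodule F (Fin 3 → F))} (hBpts : ∀ P ∈ B, finrank F P = 1)
    (harc : ∀ L : Submodule F (Fin 3 → F), finrank F L = 2 → Set.ncard {P ∈ B | P ≤ L} ≤ 2)
    {u v w : Fin 3 → F} (hu : F ∙ u ∈ B) (hv : F ∙ v ∈ B) (hw : F ∙ w ∈ B)
    (huv : F ∙ u ≠ F ∙ v) (hvw : F ∙ v ≠ F ∙ w) (huw : F ∙ u ≠ F ∙ w) :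
    LinearIndependent F ![u, v, w] := by
  by_contra hli
  set L := Submodule.span F (Set.range ![u, v, w])
  have hmem : ∀ i, F ∙ (![u, v, w] i) ≤ L := fun i =>
    Submodule.span_mono (Set.singleton_subset_iff.2 ⟨i, rfl⟩)
  have huL : F ∙ u ≤ L := hmem 0
  have hvL : F ∙ v ≤ L := hmem 1
  have hwL : F ∙ w ≤ L := hmem 2
  have hlt : finrank F L < 3 := by
    rw [linearIndependent_iff_card_le_finrank_span, not_le] at hli
    simpa [Set.finrank] using hli
  have hgt : 1 < finrank F L := by
    rw [← hBpts _ hu]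
    refine Submodule.finrank_lt_finrank_of_lt (lt_of_le_of_ne huL fun h => huv ?_)
    rw [← h] at hvL
    exact (Submodule.eq_of_le_of_finrank_eq hvL (by rw [hBpts _ hu, hBpts _ hv])).symm
  have h₂ := harc L (by omega)
  have hsub : ({F ∙ u, F ∙ v, F ∙ w} : Set (Submodule F (Fin 3 → F))) ⊆ {P ∈ B | P ≤ L} := by
    rintro P (rfl | rfl | rfl)
    exacts [⟨hu, huL⟩, ⟨hv, hvL⟩, ⟨hw, hwL⟩]
  have h₃ := Set.ncard_le_ncard hsub (Set.toFinite _)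
  rw [Set.ncard_eq_three.2 ⟨_, _, _, huv, huw, hvw, rfl⟩] at h₃
  omega

/-- Segre's theorem: an arc of `PG(2,q)`, `q` odd, has at most `q+1` points, and an arc
of exactly `q+1` points is a conic. -/
theorem segre_arc (q : ℕ) (hq : Odd q) (hppow : IsPrimePow q)
    (F : Type) [Field F] [Fintype F] (hF : Fintype.card F = q)
    (B : Set (Submodule F (Fin 3 → F)))
    (hBpts : ∀ P ∈ B, finrank F P = 1)
    (harc : ∀ L : Submodule F (Fin 3 → F), finrank F L = 2 →
      Set.ncard {P ∈ B | P ≤ L} ≤ 2) :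
    B.ncard ≤ q + 1 ∧
    (B.ncard = q + 1 →
      ∃ Q : QuadraticForm F (Fin 3 → F),
        (QuadraticMap.polarBilin Q).Nondegenerate ∧
        B = {P : Submodule F (Fin 3 → F) |
              ∃ v : Fin 3 → F, v ≠ 0 ∧ Q v = 0 ∧ P = Submodule.span F {v}}) := by
  classical
  subst hF
  have hgen : ∀ P ∈ B, ∃ v : Fin 3 → F, v ≠ 0 ∧ F ∙ v = P := by
    intro P hP
    obtain ⟨v, hv, hspan⟩ := finrank_eq_one_iff'.1 (hBpts P hP)
    refine ⟨v, by simpa using hv, le_antisymm (by simp) fun w hw => ?_⟩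
    obtain ⟨c, hc⟩ := hspan ⟨w, hw⟩
    exact Submodule.mem_span_singleton.2 ⟨c, congrArg Subtype.val hc⟩
  choose! g hg0 hg using hgen
  have hginj : Set.InjOn g B := fun P hP R hR h => by rw [← hg P hP, ← hg R hR, h]
  set S : Finset (Fin 3 → F) := (Set.toFinite (g '' B)).toFinset with hSdef
  have hmemS : ∀ {v}, v ∈ S ↔ ∃ P ∈ B, g P = v := by simp [hSdef]
  have hScard : S.card = B.ncard := by
    rw [hSdef, ← Set.ncard_eq_toFinset_card, hginj.ncard_image]
  have hspan : ∀ v ∈ S, v ≠ 0 ∧ F ∙ v ∈ B ∧ g (F ∙ v) = v := by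
    intro v hv
    obtain ⟨P, hP, rfl⟩ := hmemS.1 hv
    rw [hg P hP]
    exact ⟨hg0 P hP, hP, rfl⟩
  have hspan_ne : ∀ u ∈ S, ∀ v ∈ S, u ≠ v → F ∙ u ≠ F ∙ v := by
    intro u hu v hv huv h
    rw [← (hspan u hu).2.2, h, (hspan v hv).2.2] at huv
    exact huv rfl
  have hS : IsVectorArc S := fun x hx y hy z hz hxy hyz hxz =>
    (detForm_ne_zero_iff_linearIndependent x y z).2 (linearIndependent_of_arc hBpts harc
      (hspan x hx).2.1 (hspan y hy).2.1 (hspan z hz).2.1 (hspan_ne x hx y hy hxy)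
      (hspan_ne y hy z hz hyz) (hspan_ne x hx z hz hxz))
  rw [← hScard]
  refine ⟨hS.card_le hq, fun hcard => ?_⟩
  obtain ⟨Q, hQ, hQS, hSQ⟩ := hS.exists_quadraticForm hq hcard
  refine ⟨Q, hQ, Set.ext fun P => ⟨fun hP => ?_, ?_⟩⟩
  · exact ⟨g P, hg0 P hP, hQS _ (hmemS.2 ⟨P, hP, rfl⟩), (hg P hP).symm⟩
  · rintro ⟨w, hw, hQw, rfl⟩
    obtain ⟨x, hx, c, rfl⟩ := hSQ w hw hQw
    rw [Submodule.span_singleton_smul_eq (IsUnit.mk0 c (left_ne_zero_of_smul hw))]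
    exact (hspan x hx).2.1
end
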